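/- Let 1 ≤ p < ∞, let ρ ⊆ [0,1) be a set having 1 as a limit point, and let K ⊆ 𝕋 be compact with m(K) = 0. Then the set 𝒱_{H^p}^K(𝔻,ρ) is a dense G_δ subset of the Banach space H^p(𝔻). -/

import Mathlib

open Complex Metric Set Filter MeasureTheory Polynomial Topology

noncomputable section

/-- The Hardy `p`-norm of a function `f` on the unit disk:
`sup_{0<r<1} ((1/2π) ∫_0^{2π} |f(r e^{iθ})|^p dθ)^{1/p}`. -/
def hardyNorm (p : ℝ) (f : ℂ → ℂ) : ℝ :=
  ⨆ r : Set.Ioo (0:ℝ) 1,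
    ((1 / (2 * Real.pi)) *
      ∫ θ in (0:ℝ)..(2 * Real.pi),
        ‖f (((r : ℝ) : ℂ) * Complex.exp ((θ : ℂ) * Complex.I))‖ ^ p) ^ (1 / p)

/-- Membership in the Hardy space `H^p(𝔻)`: `f` is holomorphic on the unit disk and the
means `((1/2π) ∫_0^{2π} |f(r e^{iθ})|^p dθ)^{1/p}` are uniformly bounded for `0 < r < 1`. -/
def MemHp (p : ℝ) (f : ℂ → ℂ) : Prop :=
  DifferentiableOn ℂ f (Metric.ball (0:ℂ) 1) ∧
  BddAbove (Set.range fun r : Set.Ioo (0:ℝ) 1 =>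
    ((1 / (2 * Real.pi)) *
      ∫ θ in (0:ℝ)..(2 * Real.pi),
        ‖f (((r : ℝ) : ℂ) * Complex.exp ((θ : ℂ) * Complex.I))‖ ^ p) ^ (1 / p))

/-- The Hardy space `H^p(𝔻)` as a type. -/
def HpSpace (p : ℝ) := {f : ℂ → ℂ // MemHp p f}

/-- The norm topology on `H^p(𝔻)`, generated by the open balls of the Hardy norm. -/
instance hpTopology (p : ℝ) : TopologicalSpace (HpSpace p) :=
  TopologicalSpace.generateFrom
    {U : Set (HpSpace p) | ∃ (f : HpSpace p) (ε : ℝ), 0 < ε ∧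
      U = {g : HpSpace p | hardyNorm p (fun z => g.1 z - f.1 z) < ε}}

/-- The arc length measure of a subset `K` of the unit circle `𝕋 ⊆ ℂ`, computed as the
Lebesgue measure of the set of angles `θ ∈ [0, 2π)` with `e^{iθ} ∈ K`. -/
def arcMeasure (K : Set ℂ) : ENNReal :=
  MeasureTheory.volume {θ : ℝ | θ ∈ Set.Ico (0:ℝ) (2 * Real.pi) ∧
    Complex.exp ((θ : ℂ) * Complex.I) ∈ K}

/-- The class `𝒱_{H^p}^K(𝔻,ρ)` of functions in `H^p(𝔻)` with universal radial limits on `K`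
along dilation parameters from `ρ`. -/
def VHp (p : ℝ) (ρ : Set ℝ) (K : Set ℂ) : Set (HpSpace p) :=
  {f : HpSpace p | ∀ φ : ℂ → ℂ, ContinuousOn φ K →
    ∀ L : Set ℂ, IsCompact L → L ⊆ Metric.ball (0:ℂ) 1 →
      ∃ r : ℕ → ℝ, (∀ n, r n ∈ ρ) ∧ StrictMono r ∧
        Filter.Tendsto r Filter.atTop (nhds 1) ∧
        Filter.Tendsto
          (fun n => ⨆ ζ ∈ K, ⨆ z ∈ L, ‖f.1 (((r n : ℝ) : ℂ) * (ζ - z) + z) - φ ζ‖)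
          Filter.atTop (nhds 0)}

instance : MeasurableSpace Circle := borel Circle

instance : BorelSpace Circle := ⟨rfl⟩

/-- The normalized arc length measure on the circle group. -/
def circleMeas : Measure Circle :=
  Measure.map Circle.exp
    ((ENNReal.ofReal (2 * Real.pi))⁻¹ • volume.restrict (Ioc 0 (2 * Real.pi)))

instance : IsProbabilityMeasure circleMeas := by
  have : IsProbabilityMeasure
      ((ENNReal.ofReal (2 * Real.pi))⁻¹ • volume.restrict (Ioc 0 (2 * Real.pi))) := by
    constructor
    have h : ENNReal.ofReal (2 * Real.pi) ≠ 0 := by simp [Real.pi_pos]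
    simpa using ENNReal.inv_mul_cancel h ENNReal.ofReal_ne_top
  exact Measure.isProbabilityMeasure_map Circle.exp.continuous.measurable.aemeasurable

theorem integral_circleMeas {E : Type*} [NormedAddCommGroup E] [NormedSpace ℝ E]
    {f : Circle → E} (hf : Continuous f) :
    ∫ ω, f ω ∂circleMeas = (2 * Real.pi)⁻¹ • ∫ θ in (0:ℝ)..(2 * Real.pi), f (Circle.exp θ) := by
  rw [circleMeas, integral_map Circle.exp.continuous.measurable.aemeasurable
    hf.aestronglyMeasurable, integral_smul_measure,
    intervalIntegral.integral_of_le Real.two_pi_pos.le, ENNReal.toReal_inv,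
    ENNReal.toReal_ofReal Real.two_pi_pos.le]

theorem integrable_circleMeas {E : Type*} [NormedAddCommGroup E]
    {f : Circle → E} (hf : Continuous f) : Integrable f circleMeas :=
  hf.integrable_of_hasCompactSupport (HasCompactSupport.of_compactSpace f)

theorem integral_circleMeas_eq_circleAverage {E : Type*} [NormedAddCommGroup E] [NormedSpace ℝ E]
    {F : ℂ → E} (hF : Continuous fun ω : Circle => F ω) :
    ∫ ω : Circle, F ω ∂circleMeas = Real.circleAverage F 0 1 := by
  rw [integral_circleMeas hF, Real.circleAverage_def]
  simp [circleMap]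

theorem mul_circle_mem_ball {r : ℝ} (h0 : 0 ≤ r) {R : ℝ} (h1 : r < R) (ω : Circle) :
    (r : ℂ) * ω ∈ ball (0:ℂ) R := by
  simpa [abs_of_nonneg h0, Circle.norm_coe] using h1

theorem continuous_comp_mul_circle {f : ℂ → ℂ} {R : ℝ} (hf : ContinuousOn f (ball 0 R))
    {r : ℝ} (h0 : 0 ≤ r) (h1 : r < R) : Continuous fun ω : Circle => f (r * ω) :=
  hf.comp_continuous (by fun_prop) (mul_circle_mem_ball h0 h1)

/-- The `p`-th power integral mean of `f` over the circle of radius `r`. -/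
def powMean (p : ℝ) (f : ℂ → ℂ) (r : ℝ) : ℝ := ∫ ω : Circle, ‖f (r * ω)‖ ^ p ∂circleMeas

theorem powMean_nonneg (p : ℝ) (f : ℂ → ℂ) (r : ℝ) : 0 ≤ powMean p f r :=
  integral_nonneg fun _ => by positivity

theorem mean_eq_powMean {p : ℝ} (hp : 1 ≤ p) {f : ℂ → ℂ}
    (hf : DifferentiableOn ℂ f (ball 0 1)) {r : ℝ} (hr : r ∈ Ioo (0:ℝ) 1) :
    (1 / (2 * Real.pi)) * ∫ θ in (0:ℝ)..(2 * Real.pi),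
      ‖f ((r : ℂ) * Complex.exp ((θ : ℂ) * Complex.I))‖ ^ p = powMean p f r := by
  have h := continuous_comp_mul_circle hf.continuousOn hr.1.le hr.2
  rw [powMean, integral_circleMeas (h.norm.rpow_const fun _ => Or.inr (by linarith))]
  simp

theorem clarkson_rpow {q : ℝ} (hq : 2 ≤ q) (a b : ℂ) :
    ‖(a + b) / 2‖ ^ q + ‖(a - b) / 2‖ ^ q ≤ (‖a‖ ^ q + ‖b‖ ^ q) / 2 := by
  have key (x : ℂ) : ‖x‖ ^ q = (‖x‖ ^ 2) ^ (q / 2) := by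
    rw [← Real.rpow_natCast, ← Real.rpow_mul (norm_nonneg _)]
    congr 1
    push_cast
    ring
  have hpar : ‖(a + b) / 2‖ ^ 2 + ‖(a - b) / 2‖ ^ 2
      = 1 / 2 * ‖a‖ ^ 2 + 1 / 2 * ‖b‖ ^ 2 := by
    have := parallelogram_law_with_norm ℝ a b
    simp only [norm_div, Complex.norm_ofNat]
    linarith
  rw [key, key, key a, key b]
  calc _ ≤ (‖(a + b) / 2‖ ^ 2 + ‖(a - b) / 2‖ ^ 2) ^ (q / 2) :=
        Real.add_rpow_le_rpow_add (by positivity) (by positivity) (by linarith)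
    _ ≤ 1 / 2 * (‖a‖ ^ 2) ^ (q / 2) + 1 / 2 * (‖b‖ ^ 2) ^ (q / 2) := by
        rw [hpar]
        exact (convexOn_rpow (by linarith : 1 ≤ q / 2)).2 (mem_Ici.2 (by positivity))
          (mem_Ici.2 (by positivity)) (by norm_num) (by norm_num) (by norm_num)
    _ = _ := by ring

/-- Jensen's inequality for an average with a continuous density. -/
theorem norm_integral_rpow_le {κ : Circle → ℝ} (hκ : Continuous κ) (h0 : ∀ ω, 0 ≤ κ ω)
    (h1 : ∫ ω, κ ω ∂circleMeas = 1) {u : Circle → ℂ} (hu : Continuous u) {p : ℝ} (hp : 1 ≤ p) :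
    ‖∫ ω, κ ω • u ω ∂circleMeas‖ ^ p ≤ ∫ ω, κ ω * ‖u ω‖ ^ p ∂circleMeas := by
  set ν := circleMeas.withDensity fun ω => ENNReal.ofReal (κ ω) with hν
  have hint {E : Type} [NormedAddCommGroup E] [NormedSpace ℝ E] (g : Circle → E) :
      ∫ ω, g ω ∂ν = ∫ ω, κ ω • g ω ∂circleMeas := by
    rw [hν, integral_withDensity_eq_integral_toReal_smul (by fun_prop) (by simp)]
    simp only [ENNReal.toReal_ofReal (h0 _)]
  have : IsProbabilityMeasure ν := by
    constructor
    rw [hν, withDensity_apply _ MeasurableSet.univ, Measure.restrict_univ,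
      ← ofReal_integral_eq_lintegral_ofReal (integrable_circleMeas hκ) (ae_of_all _ h0), h1]
    simp
  have hi {g : Circle → ℝ} (hg : Continuous g) : Integrable g ν :=
    hg.integrable_of_hasCompactSupport (HasCompactSupport.of_compactSpace g)
  have hpc : Continuous fun x : ℝ => x ^ p := Real.continuous_rpow_const (by linarith)
  have hJ := (convexOn_rpow hp).map_integral_le (μ := ν) (f := fun ω => ‖u ω‖)
    hpc.continuousOn isClosed_Ici (ae_of_all _ fun ω => norm_nonneg _)
    (hi hu.norm) (hi (hpc.comp hu.norm))
  rw [hint (fun ω => ‖u ω‖ ^ p)] at hJ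
  refine le_trans ?_ hJ
  gcongr
  rw [← hint]
  exact norm_integral_le_integral_norm _

theorem integral_norm_sub_rpow_le {κ : Circle → ℝ} (hκ : Continuous κ) (h0 : ∀ ω, 0 ≤ κ ω)
    (h1 : ∫ ω, κ ω ∂circleMeas = 1) {u : Circle → ℂ} (hu : Continuous u) {q : ℝ} (hq : 2 ≤ q) :
    ∫ ω, κ ω * ‖u ω - ∫ η, κ η • u η ∂circleMeas‖ ^ q ∂circleMeas ≤
      2 ^ (q - 1) * (∫ ω, κ ω * ‖u ω‖ ^ q ∂circleMeas -
        ‖∫ η, κ η • u η ∂circleMeas‖ ^ q) := by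
  set a := ∫ η, κ η • u η ∂circleMeas with ha
  have hq0 : (0:ℝ) ≤ q := by linarith
  have hpow {g : Circle → ℂ} (hg : Continuous g) : Continuous fun ω => ‖g ω‖ ^ q :=
    hg.norm.rpow_const fun _ => Or.inr hq0
  have hm : ‖a‖ ^ q ≤ ∫ ω, κ ω * ‖(u ω + a) / 2‖ ^ q ∂circleMeas := by
    have := norm_integral_rpow_le hκ h0 h1 (u := fun ω => (u ω + a) / 2) (by fun_prop)
      (p := q) (by linarith)
    convert this using 3
    have e : ∀ ω, κ ω • ((u ω + a) / 2) = (1 / 2 : ℂ) * (κ ω • u ω) + κ ω • (a / 2) := by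
      intro ω
      simp only [real_smul]
      ring
    simp_rw [e]
    rw [integral_add (integrable_circleMeas (by fun_prop)) (integrable_circleMeas (by fun_prop)),
      integral_const_mul, integral_smul_const, h1, ← ha, one_smul]
    ring
  have hI {g : Circle → ℂ} (hg : Continuous g) :
      Integrable (fun ω => κ ω * ‖g ω‖ ^ q) circleMeas :=
    integrable_circleMeas (hκ.mul (hpow hg))
  have hc : ∫ ω, (κ ω * ‖(u ω + a) / 2‖ ^ q + κ ω * ‖(u ω - a) / 2‖ ^ q) ∂circleMeas ≤
      ∫ ω, ((1 / 2) * (κ ω * ‖u ω‖ ^ q) + κ ω * (‖a‖ ^ q / 2)) ∂circleMeas := by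
    refine integral_mono (integrable_circleMeas ?_) (integrable_circleMeas ?_) fun ω => ?_
    · exact (hκ.mul (hpow (by fun_prop))).add (hκ.mul (hpow (by fun_prop)))
    · exact (continuous_const.mul (hκ.mul (hpow hu))).add (by fun_prop)
    · have := mul_le_mul_of_nonneg_left (clarkson_rpow hq (u ω) a) (h0 ω)
      simp only
      linarith
  rw [integral_add (hI (g := fun ω => (u ω + a) / 2) (by fun_prop))
      (hI (g := fun ω => (u ω - a) / 2) (by fun_prop)),
    integral_add ((hI hu).const_mul _) (integrable_circleMeas (by fun_prop)), integral_const_mul, integral_mul_const, h1] at hc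
  have hs : ∫ ω, κ ω * ‖(u ω - a) / 2‖ ^ q ∂circleMeas
      = (2 ^ q)⁻¹ * ∫ ω, κ ω * ‖u ω - a‖ ^ q ∂circleMeas := by
    rw [← integral_const_mul]
    congr 1
    ext ω
    rw [norm_div, Real.div_rpow (norm_nonneg _) (norm_nonneg _), Complex.norm_ofNat]
    ring
  rw [hs] at hc
  have h2 : (2:ℝ) ^ q = 2 ^ (q - 1) * 2 := by
    rw [Real.rpow_sub_one (by norm_num)]
    ring
  have h3 : (0:ℝ) < 2 ^ q := by positivity
  have h4 : (2 ^ q)⁻¹ * ∫ ω, κ ω * ‖u ω - a‖ ^ q ∂circleMeas ≤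
      1 / 2 * (∫ ω, κ ω * ‖u ω‖ ^ q ∂circleMeas - ‖a‖ ^ q) := by linarith
  rw [inv_mul_le_iff₀ h3] at h4
  rw [h2] at h4
  linarith

/-- For a symmetric Markov kernel `k` and `2 ≤ q`, the `L^q` distance of `u` to its second iterate
is controlled by the loss of `L^q` mass in the first iterate. -/
theorem integral_norm_sub_markov_sq_le {k : Circle → Circle → ℝ}
    (hk : Continuous (Function.uncurry k)) (h0 : ∀ ζ ω, 0 ≤ k ζ ω)
    (hsymm : ∀ ζ ω, k ζ ω = k ω ζ) (h1 : ∀ ζ, ∫ ω, k ζ ω ∂circleMeas = 1)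
    {u v w : Circle → ℂ} (hu : Continuous u) (hv : Continuous v) (hw : Continuous w)
    (huv : ∀ ζ, ∫ ω, k ζ ω • u ω ∂circleMeas = v ζ)
    (hvw : ∀ ζ, ∫ ω, k ζ ω • v ω ∂circleMeas = w ζ) {q : ℝ} (hq : 2 ≤ q) :
    ∫ ω, ‖u ω - w ω‖ ^ q ∂circleMeas ≤
      2 ^ (q - 1) * (∫ ω, ‖u ω‖ ^ q ∂circleMeas - ∫ ω, ‖v ω‖ ^ q ∂circleMeas) := by
  have hq0 : (0:ℝ) ≤ q := by linarith
  have hkl (ζ : Circle) : Continuous (k ζ) := hk.comp (by fun_prop : Continuous fun ω => (ζ, ω))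
  have hswap {F : Circle → Circle → ℝ} (hF : Continuous (Function.uncurry F)) :
      ∫ ζ, ∫ ω, F ζ ω ∂circleMeas ∂circleMeas = ∫ ω, ∫ ζ, F ζ ω ∂circleMeas ∂circleMeas :=
    integral_integral_swap (hF.integrable_of_hasCompactSupport
      (HasCompactSupport.of_compactSpace _))
  have hpar {F : Circle → Circle → ℝ} (hF : Continuous (Function.uncurry F)) :
      Continuous fun ζ => ∫ ω, F ζ ω ∂circleMeas := by
    have := continuous_parametric_integral_of_continuous (μ := circleMeas) hF isCompact_univ
    simpa using this
  have hF1 : Continuous (Function.uncurry fun ζ ω => k ζ ω * ‖u ω - v ζ‖ ^ q) :=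
    hk.mul ((by fun_prop : Continuous fun x : Circle × Circle => ‖u x.2 - v x.1‖).rpow_const
      fun _ => Or.inr hq0)
  have hF2 : Continuous (Function.uncurry fun ζ ω => k ζ ω * ‖u ω‖ ^ q) :=
    hk.mul ((by fun_prop : Continuous fun x : Circle × Circle => ‖u x.2‖).rpow_const
      fun _ => Or.inr hq0)
  have hvq : Continuous fun ζ => ‖v ζ‖ ^ q := hv.norm.rpow_const fun _ => Or.inr hq0
  have hswapped : Continuous (Function.uncurry fun ω ζ => k ζ ω * ‖u ω - v ζ‖ ^ q) :=
    hF1.comp continuous_swap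
  calc ∫ ω, ‖u ω - w ω‖ ^ q ∂circleMeas
      ≤ ∫ ω, ∫ ζ, k ζ ω * ‖u ω - v ζ‖ ^ q ∂circleMeas ∂circleMeas := by
        refine integral_mono (integrable_circleMeas
          ((hu.sub hw).norm.rpow_const fun _ => Or.inr hq0))
          (integrable_circleMeas (hpar hswapped)) fun ω => ?_
        have := norm_integral_rpow_le (hkl ω) (h0 ω) (h1 ω) (u := fun ζ => u ω - v ζ)
          (by fun_prop) (p := q) (by linarith)
        simp only [hsymm ω, smul_sub] at this
        rw [integral_sub (integrable_circleMeas (by simp_rw [← hsymm ω]; fun_prop))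
          (integrable_circleMeas (by simp_rw [← hsymm ω]; fun_prop)), integral_smul_const] at this
        simp_rw [← hsymm ω] at this
        rw [h1, hvw, one_smul] at this
        simpa only [hsymm ω] using this
    _ = ∫ ζ, ∫ ω, k ζ ω * ‖u ω - v ζ‖ ^ q ∂circleMeas ∂circleMeas := (hswap hF1).symm
    _ ≤ ∫ ζ, 2 ^ (q - 1) * (∫ ω, k ζ ω * ‖u ω‖ ^ q ∂circleMeas - ‖v ζ‖ ^ q) ∂circleMeas := by
        refine integral_mono (integrable_circleMeas (hpar hF1))
          (integrable_circleMeas (continuous_const.mul ((hpar hF2).sub hvq))) fun ζ => ?_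
        have := integral_norm_sub_rpow_le (hkl ζ) (h0 ζ) (h1 ζ) hu hq
        simpa only [huv] using this
    _ = _ := by
        rw [integral_const_mul, integral_sub (integrable_circleMeas (hpar hF2))
          (integrable_circleMeas hvq), hswap hF2]
        simp_rw [integral_mul_const, fun ω ζ => hsymm ζ ω, h1, one_mul]

/-- The Poisson kernel at the point `t ζ`, as a function on the circle. -/
def circlePoisson (t : ℝ) (ζ ω : Circle) : ℝ := (1 - t ^ 2) / ‖(ω : ℂ) - t * ζ‖ ^ 2

theorem one_sub_le_norm_sub {t : ℝ} (h0 : 0 ≤ t) (ζ ω : Circle) :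
    1 - t ≤ ‖(ω : ℂ) - t * ζ‖ := by
  have := norm_sub_norm_le (ω : ℂ) (t * ζ)
  simpa [abs_of_nonneg h0, Circle.norm_coe] using this

theorem circlePoisson_nonneg {t : ℝ} (h0 : 0 ≤ t) (h1 : t < 1) (ζ ω : Circle) :
    0 ≤ circlePoisson t ζ ω :=
  div_nonneg (by nlinarith) (by positivity)

theorem circlePoisson_le {t : ℝ} (h0 : 0 ≤ t) (h1 : t < 1) (ζ ω : Circle) :
    circlePoisson t ζ ω ≤ 2 / (1 - t) := by
  have ht : 0 < 1 - t := by linarith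
  have h := one_sub_le_norm_sub h0 ζ ω
  have h2 : (1 - t) ^ 2 ≤ ‖(ω : ℂ) - t * ζ‖ ^ 2 := by gcongr
  have hpos : 0 < (1 - t) ^ 2 := by positivity
  rw [circlePoisson, div_le_div_iff₀ (by linarith) ht]
  nlinarith

theorem circlePoisson_symm (t : ℝ) (ζ ω : Circle) : circlePoisson t ζ ω = circlePoisson t ω ζ := by
  have h (ζ ω : Circle) : ‖(ω : ℂ) - t * ζ‖ ^ 2 = 1 + t ^ 2 - 2 * t * (ω.1.re * ζ.1.re +
      ω.1.im * ζ.1.im) := by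
    have h1 : ω.1.re * ω.1.re + ω.1.im * ω.1.im = 1 := by
      rw [← normSq_apply]; exact Circle.normSq_coe ω
    have h2 : ζ.1.re * ζ.1.re + ζ.1.im * ζ.1.im = 1 := by
      rw [← normSq_apply]; exact Circle.normSq_coe ζ
    rw [← normSq_eq_norm_sq, normSq_apply]
    simp only [sub_re, sub_im, re_ofReal_mul, im_ofReal_mul]
    linear_combination h1 + t ^ 2 * h2
  rw [circlePoisson, circlePoisson, h, h]
  ring_nf

theorem continuous_circlePoisson {t : ℝ} (h0 : 0 ≤ t) (h1 : t < 1) :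
    Continuous (Function.uncurry (circlePoisson t)) := by
  refine Continuous.div (by fun_prop) (by fun_prop) fun x => ?_
  have := one_sub_le_norm_sub h0 x.1 x.2
  have h : 0 < ‖(x.2 : ℂ) - t * x.1‖ := by linarith
  positivity

theorem integral_circlePoisson_smul {f : ℂ → ℂ} {R s : ℝ} (hf : DifferentiableOn ℂ f (ball 0 R))
    (hs : 0 < s) (hsR : s < R) {t : ℝ} (h0 : 0 ≤ t) (h1 : t < 1) (ζ : Circle) :
    ∫ ω, circlePoisson t ζ ω • f (s * ω) ∂circleMeas = f ((s * t : ℝ) * ζ) := by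
  have hg : DiffContOnCl ℂ (fun z => f (s * z)) (ball 0 1) := by
    refine (DifferentiableOn.diffContOnCl_ball (U := closedBall 0 1) ?_ le_rfl)
    refine hf.comp (by fun_prop) fun z hz => ?_
    simp only [mem_closedBall, dist_zero_right, mem_ball, norm_mul, norm_real, Real.norm_eq_abs,
      abs_of_pos hs] at hz ⊢
    nlinarith
  have hw : (t : ℂ) * ζ ∈ ball (0:ℂ) 1 := mul_circle_mem_ball h0 h1 ζ
  have h := hg.circleAverage_poissonKernel_smul' hw
  rw [show ((s * t : ℝ) : ℂ) * ζ = s * (t * ζ) by push_cast; ring, ← h,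
    ← integral_circleMeas_eq_circleAverage]
  · simp [circlePoisson, Circle.norm_coe]
  · have e : ∀ ω : Circle, ((‖(ω : ℂ) - 0‖ ^ 2 - ‖(t : ℂ) * ζ - 0‖ ^ 2) /
        ‖(ω : ℂ) - 0 - ((t : ℂ) * ζ - 0)‖ ^ 2) = circlePoisson t ζ ω := by
      intro ω; simp [circlePoisson, Circle.norm_coe]
    simp_rw [e]
    exact ((continuous_circlePoisson h0 h1).comp (by fun_prop : Continuous fun ω => (ζ, ω))).smul
      (continuous_comp_mul_circle hf.continuousOn hs.le hsR)

theorem continuous_circlePoisson_left {t : ℝ} (h0 : 0 ≤ t) (h1 : t < 1) (ζ : Circle) :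
    Continuous (circlePoisson t ζ) :=
  (continuous_circlePoisson h0 h1).comp (by fun_prop : Continuous fun ω => (ζ, ω))

theorem integral_circlePoisson {t : ℝ} (h0 : 0 ≤ t) (h1 : t < 1) (ζ : Circle) :
    ∫ ω, circlePoisson t ζ ω ∂circleMeas = 1 := by
  have := integral_circlePoisson_smul (f := fun _ => 1) (R := 2) (s := 1) (by fun_prop)
    one_pos one_lt_two h0 h1 ζ
  simp only [real_smul, mul_one] at this
  rw [integral_complex_ofReal] at this
  exact_mod_cast this

theorem norm_rpow_le_integral_circlePoisson {p : ℝ} (hp : 1 ≤ p) {f : ℂ → ℂ} {R s : ℝ}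
    (hf : DifferentiableOn ℂ f (ball 0 R)) (hs : 0 < s) (hsR : s < R) {t : ℝ} (h0 : 0 ≤ t)
    (h1 : t < 1) (ζ : Circle) :
    ‖f ((s * t : ℝ) * ζ)‖ ^ p ≤
      ∫ ω, circlePoisson t ζ ω * ‖f (s * ω)‖ ^ p ∂circleMeas := by
  rw [← integral_circlePoisson_smul hf hs hsR h0 h1 ζ]
  exact norm_integral_rpow_le (continuous_circlePoisson_left h0 h1 ζ) (circlePoisson_nonneg h0 h1 ζ)
    (integral_circlePoisson h0 h1 ζ) (continuous_comp_mul_circle hf.continuousOn hs.le hsR) hp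

theorem continuous_norm_rpow {p : ℝ} (hp : 1 ≤ p) {f : ℂ → ℂ} {R r : ℝ}
    (hf : ContinuousOn f (ball 0 R)) (h0 : 0 ≤ r) (h1 : r < R) :
    Continuous fun ω : Circle => ‖f (r * ω)‖ ^ p :=
  (continuous_comp_mul_circle hf h0 h1).norm.rpow_const fun _ => Or.inr (by linarith)

theorem powMean_mono {p : ℝ} (hp : 1 ≤ p) {f : ℂ → ℂ} {R : ℝ}
    (hf : DifferentiableOn ℂ f (ball 0 R)) {r s : ℝ} (hr : 0 ≤ r) (hrs : r ≤ s) (hsR : s < R) :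
    powMean p f r ≤ powMean p f s := by
  rcases hrs.eq_or_lt with rfl | hlt
  · rfl
  have hs : 0 < s := hr.trans_lt hlt
  have h0 : 0 ≤ r / s := by positivity
  have h1 : r / s < 1 := (div_lt_one hs).2 hlt
  have hF : Continuous (Function.uncurry fun ζ ω : Circle =>
      circlePoisson (r / s) ζ ω * ‖f (s * ω)‖ ^ p) :=
    (continuous_circlePoisson h0 h1).mul
      ((continuous_norm_rpow hp hf.continuousOn hs.le hsR).comp continuous_snd)
  have hpar : Continuous fun ζ => ∫ ω, circlePoisson (r / s) ζ ω * ‖f (s * ω)‖ ^ p ∂circleMeas := by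
    simpa using continuous_parametric_integral_of_continuous (μ := circleMeas) hF isCompact_univ
  calc powMean p f r
      ≤ ∫ ζ, ∫ ω, circlePoisson (r / s) ζ ω * ‖f (s * ω)‖ ^ p ∂circleMeas ∂circleMeas := by
        refine integral_mono (integrable_circleMeas
          (continuous_norm_rpow hp hf.continuousOn hr (hrs.trans_lt hsR)))
          (integrable_circleMeas hpar) fun ζ => ?_
        have := norm_rpow_le_integral_circlePoisson hp hf hs hsR h0 h1 ζ
        rwa [mul_div_cancel₀ _ hs.ne'] at this
    _ = ∫ ω, ∫ ζ, circlePoisson (r / s) ζ ω * ‖f (s * ω)‖ ^ p ∂circleMeas ∂circleMeas :=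
        integral_integral_swap (hF.integrable_of_hasCompactSupport
          (HasCompactSupport.of_compactSpace _))
    _ = powMean p f s := by
        simp_rw [integral_mul_const, fun ω ζ => circlePoisson_symm (r / s) ζ ω,
          integral_circlePoisson h0 h1, one_mul]
        rfl

theorem exists_eq_mul_circle (z : ℂ) : ∃ ζ : Circle, z = (‖z‖ : ℂ) * ζ :=
  ⟨Circle.exp (arg z), by simp [norm_mul_exp_arg_mul_I]⟩

theorem norm_rpow_le_powMean {p : ℝ} (hp : 1 ≤ p) {f : ℂ → ℂ} {R s : ℝ}
    (hf : DifferentiableOn ℂ f (ball 0 R)) (hs : 0 < s) (hsR : s < R) {z : ℂ} (hz : ‖z‖ < s) :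
    ‖f z‖ ^ p ≤ 2 / (1 - ‖z‖ / s) * powMean p f s := by
  obtain ⟨ζ, hζ⟩ := exists_eq_mul_circle z
  have h0 : 0 ≤ ‖z‖ / s := by positivity
  have h1 : ‖z‖ / s < 1 := (div_lt_one hs).2 hz
  have h := norm_rpow_le_integral_circlePoisson hp hf hs hsR h0 h1 ζ
  rw [mul_div_cancel₀ _ hs.ne', ← hζ] at h
  have hc := continuous_norm_rpow hp hf.continuousOn hs.le hsR
  refine h.trans ?_
  rw [powMean, ← integral_const_mul]
  refine integral_mono (integrable_circleMeas ((continuous_circlePoisson_left h0 h1 ζ).mul hc))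
    (integrable_circleMeas (continuous_const.mul hc)) fun ω => ?_
  exact mul_le_mul_of_nonneg_right (circlePoisson_le h0 h1 ζ ω) (by positivity)

theorem powMean_sub_dilate_sq_le {q : ℝ} (hq : 2 ≤ q) {f : ℂ → ℂ} {R : ℝ} (hR : 1 < R)
    (hf : DifferentiableOn ℂ f (ball 0 R)) {t : ℝ} (h0 : 0 ≤ t) (h1 : t < 1) :
    ∫ ω : Circle, ‖f ω - f ((t * t : ℝ) * ω)‖ ^ q ∂circleMeas ≤
      2 ^ (q - 1) * (powMean q f 1 - powMean q f t) := by
  have hc {r : ℝ} (h0 : 0 ≤ r) (h1 : r < R) := continuous_comp_mul_circle hf.continuousOn h0 h1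
  have hc1 : Continuous fun ω : Circle => f ω := by simpa using hc zero_le_one hR
  have h := integral_norm_sub_markov_sq_le (continuous_circlePoisson h0 h1)
    (circlePoisson_nonneg h0 h1) (circlePoisson_symm t) (integral_circlePoisson h0 h1)
    (u := fun ω => f ω) (v := fun ω => f (t * ω)) (w := fun ω => f ((t * t : ℝ) * ω))
    hc1 (hc h0 (h1.trans hR)) (hc (by positivity) (by nlinarith))
    (fun ζ => by simpa using integral_circlePoisson_smul hf one_pos hR h0 h1 ζ)
    (fun ζ => ?_) hq
  · simpa [powMean] using h
  · rcases h0.eq_or_lt with rfl | ht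
    · simp only [ofReal_zero, zero_mul, mul_zero]
      rw [integral_smul_const, integral_circlePoisson le_rfl one_pos, one_smul]
    · exact integral_circlePoisson_smul hf ht (h1.trans hR) h0 h1 ζ

theorem exists_removed_zero {f : ℂ → ℂ} {U : Set ℂ} (hU : IsOpen U) (hf : DifferentiableOn ℂ f U)
    {a : ℂ} (ha : a ∈ U) (hfa : ¬ ∀ᶠ z in 𝓝 a, f z = 0) :
    ∃ (n : ℕ) (h : ℂ → ℂ), DifferentiableOn ℂ h U ∧ h a ≠ 0 ∧ ∀ z, z ≠ a → f z = (z - a) ^ n * h z := by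
  have hfan : AnalyticAt ℂ f a := hf.analyticAt (hU.mem_nhds ha)
  have hord : analyticOrderAt f a ≠ ⊤ := by
    rwa [ne_eq, analyticOrderAt_eq_top]
  obtain ⟨h0, h0an, h0a, h0f⟩ := (hfan.analyticOrderAt_ne_top).1 hord
  set n := analyticOrderNatAt f a
  refine ⟨n, Function.update (fun z => f z / (z - a) ^ n) a (h0 a), ?_, by simpa using h0a, ?_⟩
  · intro z hz
    rcases eq_or_ne z a with rfl | hza
    · refine (h0an.differentiableAt.congr_of_eventuallyEq ?_).differentiableWithinAt
      filter_upwards [h0f] with w hw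
      rcases eq_or_ne w z with rfl | hwz
      · simp
      · have : (w - z) ^ n ≠ 0 := pow_ne_zero _ (sub_ne_zero.2 hwz)
        rw [Function.update_of_ne hwz, hw, smul_eq_mul, mul_div_cancel_left₀ _ this]
    · refine DifferentiableAt.differentiableWithinAt ?_
      have hd : DifferentiableAt ℂ (fun z => f z / (z - a) ^ n) z :=
        (hf.differentiableAt (hU.mem_nhds hz)).div (by fun_prop)
          (pow_ne_zero _ (sub_ne_zero.2 hza))
      refine hd.congr_of_eventuallyEq ?_
      filter_upwards [isOpen_ne.mem_nhds hza] with w hw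
      rw [Function.update_of_ne hw]
  · intro z hza
    have : (z - a) ^ n ≠ 0 := pow_ne_zero _ (sub_ne_zero.2 hza)
    rw [Function.update_of_ne hza, mul_div_cancel₀ _ this]

theorem norm_sub_eq_norm_one_sub {a z : ℂ} (hz : ‖z‖ = 1) :
    ‖1 - starRingEnd ℂ a * z‖ = ‖z - a‖ := by
  have h : 1 - starRingEnd ℂ a * z = z * starRingEnd ℂ (z - a) := by
    have : z * starRingEnd ℂ z = 1 := by rw [mul_conj, normSq_eq_norm_sq, hz]; simp
    rw [map_sub, mul_sub, this]
    ring
  rw [h, norm_mul, hz, one_mul, RCLike.norm_conj]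

/-- The zeros of `f` in the unit disk can be reflected away without changing `‖f‖` on the unit
circle. -/
theorem exists_zero_free_of_ncard (n : ℕ) {f : ℂ → ℂ} {R : ℝ} (hR : 1 < R)
    (hf : DifferentiableOn ℂ f (ball 0 R)) (hfz : ∀ z, ‖z‖ = 1 → f z ≠ 0)
    (hfin : {z | z ∈ closedBall (0:ℂ) 1 ∧ f z = 0}.Finite)
    (hn : {z | z ∈ closedBall (0:ℂ) 1 ∧ f z = 0}.ncard = n) :
    ∃ g : ℂ → ℂ, DifferentiableOn ℂ g (ball 0 R) ∧ (∀ z ∈ closedBall (0:ℂ) 1, g z ≠ 0) ∧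
      ∀ z, ‖z‖ = 1 → ‖g z‖ = ‖f z‖ := by
  induction n generalizing f with
  | zero =>
    rw [Set.ncard_eq_zero hfin] at hn
    exact ⟨f, hf, fun z hz h => (hn ▸ (⟨hz, h⟩ : z ∈ {z | z ∈ closedBall (0:ℂ) 1 ∧ f z = 0}) :
      z ∈ (∅ : Set ℂ)), fun _ _ => rfl⟩
  | succ n ih =>
    obtain ⟨a, ha1, ha0⟩ := Set.nonempty_of_ncard_ne_zero (by omega :
      {z | z ∈ closedBall (0:ℂ) 1 ∧ f z = 0}.ncard ≠ 0)
    have hmem : a ∈ {z | z ∈ closedBall (0:ℂ) 1 ∧ f z = 0} := ⟨ha1, ha0⟩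
    have haR : a ∈ ball (0:ℂ) R := closedBall_subset_ball hR ha1
    have hna : ‖a‖ < 1 := by
      refine lt_of_le_of_ne (by simpa using ha1) fun h => hfz a h ha0
    have hev : ¬ ∀ᶠ z in 𝓝 a, f z = 0 := by
      intro h
      have hinf : {z | f z = 0 ∧ z ∈ ball (0:ℂ) 1} ∈ 𝓝 a :=
        h.and (isOpen_ball.mem_nhds (by simpa using hna))
      refine infinite_of_mem_nhds a hinf (hfin.subset fun z hz => ⟨?_, hz.1⟩)
      exact ball_subset_closedBall hz.2
    obtain ⟨m, h, hh, hha, hfh⟩ := exists_removed_zero isOpen_ball hf haR hev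
    set g : ℂ → ℂ := fun z => (1 - starRingEnd ℂ a * z) ^ m * h z with hg
    have hgf : ∀ z, ‖z‖ = 1 → ‖g z‖ = ‖f z‖ := by
      intro z hz
      have hza : z ≠ a := by rintro rfl; linarith
      rw [hg, hfh z hza, norm_mul, norm_mul, norm_pow, norm_pow, norm_sub_eq_norm_one_sub hz]
    have hfac : ∀ z ∈ closedBall (0:ℂ) 1, 1 - starRingEnd ℂ a * z ≠ 0 := by
      intro z hz h0
      have h1 : ‖starRingEnd ℂ a * z‖ = 1 := by rw [← sub_eq_zero.1 h0]; simp
      rw [norm_mul, RCLike.norm_conj] at h1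
      have : ‖z‖ ≤ 1 := by simpa using hz
      nlinarith [norm_nonneg a, norm_nonneg z]
    have hset : {z | z ∈ closedBall (0:ℂ) 1 ∧ g z = 0} =
        {z | z ∈ closedBall (0:ℂ) 1 ∧ f z = 0} \ {a} := by
      ext z
      simp only [Set.mem_ofPred_eq, Set.mem_sdiff, mem_singleton_iff]
      constructor
      · rintro ⟨hz, hgz⟩
        have hz0 : h z = 0 := (mul_eq_zero.1 hgz).resolve_left (pow_ne_zero _ (hfac z hz))
        have hza : z ≠ a := by rintro rfl; exact hha hz0
        exact ⟨⟨hz, by rw [hfh z hza, hz0, mul_zero]⟩, hza⟩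
      · rintro ⟨⟨hz, hfz0⟩, hza⟩
        refine ⟨hz, ?_⟩
        rw [hfh z hza] at hfz0
        have := (mul_eq_zero.1 hfz0).resolve_left (pow_ne_zero _ (sub_ne_zero.2 hza))
        simp [hg, this]
    obtain ⟨k, hk, hk0, hkg⟩ := ih (f := g) (by fun_prop)
      (fun z hz h0 => hfz z hz (by rw [← norm_eq_zero, ← hgf z hz, h0, norm_zero]))
      (hset ▸ hfin.subset sdiff_subset)
      (by rw [hset, Set.ncard_sdiff_singleton_of_mem hmem, hn]; rfl)
    exact ⟨k, hk, hk0, fun z hz => (hkg z hz).trans (hgf z hz)⟩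

theorem exists_sqrt_of_zero_free {g : ℂ → ℂ} {R : ℝ} (hR : 0 < R)
    (hg : DifferentiableOn ℂ g (ball 0 R)) (h0 : ∀ z ∈ ball (0:ℂ) R, g z ≠ 0) :
    ∃ v : ℂ → ℂ, DifferentiableOn ℂ v (ball 0 R) ∧ ∀ z ∈ ball (0:ℂ) R, v z ^ 2 = g z := by
  have hd : DifferentiableOn ℂ (fun z => deriv g z / g z) (ball 0 R) :=
    (hg.deriv isOpen_ball).div hg h0
  have hc0 : (0:ℂ) ∈ ball (0:ℂ) R := by simpa using hR
  obtain ⟨l, hl0, hl⟩ := hd.isExactOn_ball.with_val_at 0 (Complex.log (g 0))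
  have hE : ∀ z ∈ ball (0:ℂ) R, HasDerivAt (fun z => g z * Complex.exp (-l z)) 0 z := by
    intro z hz
    have hd' := (hg.differentiableAt (isOpen_ball.mem_nhds hz)).hasDerivAt
    refine (hd'.mul (hl z hz).neg.cexp).congr_deriv ?_
    rw [mul_neg, mul_neg, mul_comm (Complex.exp _), ← mul_assoc, mul_div_cancel₀ _ (h0 z hz),
      add_neg_cancel]
  have hconst : ∀ z ∈ ball (0:ℂ) R, g z * Complex.exp (-l z) = 1 := by
    intro z hz
    have := isOpen_ball.is_const_of_deriv_eq_zero (convex_ball (0:ℂ) R).isPreconnected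
      (fun z hz => (hE z hz).differentiableAt.differentiableWithinAt)
      (fun z hz => (hE z hz).deriv) hz hc0
    rw [this, hl0, Complex.exp_neg, Complex.exp_log (h0 0 hc0), mul_inv_cancel₀ (h0 0 hc0)]
  refine ⟨fun z => Complex.exp (l z / 2), ?_, fun z hz => ?_⟩
  · intro z hz
    exact ((hl z hz).differentiableAt.div_const 2).cexp.differentiableWithinAt
  · have h1 := hconst z hz
    rw [← Complex.exp_nat_mul]
    rw [Complex.exp_neg] at h1
    push_cast
    rw [mul_div_cancel₀ _ (two_ne_zero)]
    exact ((mul_inv_eq_one₀ (Complex.exp_ne_zero _)).1 h1).symm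

theorem finite_zeros_closedBall {f : ℂ → ℂ} {R s : ℝ} (hf : DifferentiableOn ℂ f (ball 0 R))
    (hs : s < R) (hne : ∃ z ∈ ball (0:ℂ) R, f z ≠ 0) :
    {z | z ∈ closedBall (0:ℂ) s ∧ f z = 0}.Finite := by
  by_contra hinf
  obtain ⟨a, ha, hacc⟩ := Set.Infinite.exists_accPt_of_subset_isCompact hinf
    (isCompact_closedBall (0:ℂ) s) (fun z hz => hz.1)
  obtain ⟨w, hw, hfw⟩ := hne
  refine hfw ((hf.analyticOnNhd isOpen_ball).eqOn_zero_of_preconnected_of_frequently_eq_zero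
    (convex_ball (0:ℂ) R).isPreconnected (closedBall_subset_ball hs ha) ?_ hw)
  exact (accPt_iff_frequently_nhdsNE.1 hacc).mono fun z hz => hz.2

theorem exists_mul_factorization {f : ℂ → ℂ} {R : ℝ} (hR : 1 < R)
    (hf : DifferentiableOn ℂ f (ball 0 R)) (hfz : ∀ z, ‖z‖ = 1 → f z ≠ 0) :
    ∃ (R' : ℝ) (u v : ℂ → ℂ), 1 < R' ∧ DifferentiableOn ℂ u (ball 0 R') ∧
      DifferentiableOn ℂ v (ball 0 R') ∧ (∀ z ∈ ball (0:ℂ) R', f z = u z * v z) ∧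
      ∀ z, ‖z‖ = 1 → ‖u z‖ ^ 2 = ‖f z‖ ∧ ‖v z‖ ^ 2 = ‖f z‖ := by
  have hfin := finite_zeros_closedBall hf hR ⟨1, by simpa using hR, hfz 1 (by simp)⟩
  obtain ⟨g, hg, hg0, hgf⟩ := exists_zero_free_of_ncard _ hR hf hfz hfin rfl
  have hO : IsOpen (ball (0:ℂ) R ∩ g ⁻¹' {0}ᶜ) :=
    hg.continuousOn.isOpen_inter_preimage isOpen_ball isOpen_compl_singleton
  obtain ⟨δ, hδ, hsub⟩ := (isCompact_closedBall (0:ℂ) 1).exists_thickening_subset_open hO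
    (fun z hz => ⟨closedBall_subset_ball hR hz, hg0 z hz⟩)
  rw [thickening_closedBall hδ zero_le_one] at hsub
  have hR' : 1 < δ + 1 := by linarith
  have hgR : DifferentiableOn ℂ g (ball 0 (δ + 1)) := hg.mono fun z hz => (hsub hz).1
  obtain ⟨v, hv, hvg⟩ := exists_sqrt_of_zero_free (by linarith) hgR fun z hz => (hsub hz).2
  have hv0 : ∀ z ∈ ball (0:ℂ) (δ + 1), v z ≠ 0 := by
    intro z hz h
    refine (hsub hz).2 ?_
    simp [← hvg z hz, h]
  refine ⟨δ + 1, fun z => f z / v z, v, hR', ?_, hv, fun z hz => ?_, fun z hz => ?_⟩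
  · exact (hf.mono fun z hz => (hsub hz).1).div hv hv0
  · rw [div_mul_cancel₀ _ (hv0 z hz)]
  · have hz' : z ∈ ball (0:ℂ) (δ + 1) := by simpa [hz] using hδ
    have h1 : ‖v z‖ ^ 2 = ‖f z‖ := by rw [← norm_pow, hvg z hz', hgf z hz]
    refine ⟨?_, h1⟩
    have : ‖f z‖ ≠ 0 := norm_ne_zero_iff.2 (hfz z hz)
    rw [norm_div, div_pow, h1, sq, mul_div_cancel_right₀ _ this]

theorem add_rpow_le_two_rpow_mul {p : ℝ} (hp : 1 ≤ p) {a b : ℝ} (ha : 0 ≤ a) (hb : 0 ≤ b) :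
    (a + b) ^ p ≤ 2 ^ (p - 1) * (a ^ p + b ^ p) := by
  lift a to NNReal using ha
  lift b to NNReal using hb
  exact_mod_cast NNReal.rpow_add_le_mul_rpow_add_rpow a b hp

theorem mul_rpow_le_weighted {p l a b : ℝ} (hl : 0 < l) (ha : 0 ≤ a) (hb : 0 ≤ b) :
    (a * b) ^ p ≤ (l * a ^ (2 * p) + l⁻¹ * b ^ (2 * p)) / 2 := by
  rw [Real.mul_rpow ha hb, mul_comm 2 p, Real.rpow_mul ha, Real.rpow_mul hb, Real.rpow_two,
    Real.rpow_two]
  have h : l * l⁻¹ = 1 := mul_inv_cancel₀ hl.ne'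
  have h1 : l * (a ^ p) ^ 2 + l⁻¹ * (b ^ p) ^ 2 - 2 * (a ^ p * b ^ p) =
      l * (a ^ p - l⁻¹ * b ^ p) ^ 2 := by
    linear_combination (2 * a ^ p * b ^ p - (b ^ p) ^ 2 * l⁻¹) * h
  have h2 : 0 ≤ l * (a ^ p - l⁻¹ * b ^ p) ^ 2 := by positivity
  linarith

theorem norm_mul_sub_mul_rpow_le {p l : ℝ} (hp : 1 ≤ p) (hl : 0 < l) (a b a' b' : ℂ) :
    ‖a * b - a' * b'‖ ^ p ≤ 2 ^ (p - 1) * ((l * ‖a‖ ^ (2 * p) + l⁻¹ * ‖b - b'‖ ^ (2 * p)) / 2 +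
      (l * ‖b'‖ ^ (2 * p) + l⁻¹ * ‖a - a'‖ ^ (2 * p)) / 2) := by
  have h1 : ‖a * b - a' * b'‖ ≤ ‖a‖ * ‖b - b'‖ + ‖b'‖ * ‖a - a'‖ := by
    rw [show a * b - a' * b' = a * (b - b') + b' * (a - a') by ring]
    exact (norm_add_le _ _).trans (by rw [norm_mul, norm_mul])
  refine (Real.rpow_le_rpow (norm_nonneg _) h1 (by linarith)).trans ?_
  refine (add_rpow_le_two_rpow_mul hp (by positivity) (by positivity)).trans ?_
  gcongr
  · exact mul_rpow_le_weighted hl (norm_nonneg _) (norm_nonneg _)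
  · exact mul_rpow_le_weighted hl (norm_nonneg _) (norm_nonneg _)

theorem integral_combination {a b c d : Circle → ℝ} (ha : Continuous a) (hb : Continuous b)
    (hc : Continuous c) (hd : Continuous d) (k l m : ℝ) :
    ∫ ω, k * ((l * a ω + m * b ω) / 2 + (l * c ω + m * d ω) / 2) ∂circleMeas =
      k * ((l * ∫ ω, a ω ∂circleMeas + m * ∫ ω, b ω ∂circleMeas) / 2 +
        (l * ∫ ω, c ω ∂circleMeas + m * ∫ ω, d ω ∂circleMeas) / 2) := by
  have i1 := (integrable_circleMeas ha).const_mul l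
  have i2 := (integrable_circleMeas hb).const_mul m
  have i3 := (integrable_circleMeas hc).const_mul l
  have i4 := (integrable_circleMeas hd).const_mul m
  have i12 : Integrable (fun ω => (l * a ω + m * b ω) / 2) circleMeas := (i1.add i2).div_const 2
  have i34 : Integrable (fun ω => (l * c ω + m * d ω) / 2) circleMeas := (i3.add i4).div_const 2
  rw [integral_const_mul, integral_add i12 i34, integral_div, integral_div, integral_add i1 i2,
    integral_add i3 i4]
  simp only [integral_const_mul]

/-- If `f` has no zeros on the unit circle, the distance from `f` to its dilate is controlled by
the increment of its integral means. -/
theorem powMean_sub_dilate_le {p l : ℝ} (hp : 1 ≤ p) (hl : 0 < l) {f : ℂ → ℂ} {R : ℝ} (hR : 1 < R)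
    (hf : DifferentiableOn ℂ f (ball 0 R)) (hfz : ∀ z, ‖z‖ = 1 → f z ≠ 0) {t : ℝ} (h0 : 0 ≤ t)
    (h1 : t < 1) :
    powMean p (fun z => f z - f ((t * t : ℝ) * z)) 1 ≤ 2 ^ (p - 1) * (l * powMean p f 1 +
      l⁻¹ * (2 ^ (2 * p - 1) * (powMean p f 1 - powMean p f t))) := by
  obtain ⟨R', u, v, hR', hu, hv, huv, hcirc⟩ := exists_mul_factorization hR hf hfz
  have htt0 : 0 ≤ t * t := by positivity
  have htt1 : t * t < 1 := by nlinarith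
  have hmem {r : ℝ} (h0 : 0 ≤ r) (h1 : r ≤ 1) (ω : Circle) : (r : ℂ) * ω ∈ ball (0:ℂ) R' :=
    mul_circle_mem_ball h0 (h1.trans_lt hR') ω
  have hq : 1 ≤ 2 * p := by linarith
  have hcu {r : ℝ} (h0 : 0 ≤ r) (h1 : r ≤ 1) :=
    continuous_comp_mul_circle hu.continuousOn h0 (h1.trans_lt hR')
  have hcv {r : ℝ} (h0 : 0 ≤ r) (h1 : r ≤ 1) :=
    continuous_comp_mul_circle hv.continuousOn h0 (h1.trans_lt hR')
  have hpc {g : Circle → ℂ} (hg : Continuous g) : Continuous fun ω => ‖g ω‖ ^ (2 * p) :=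
    hg.norm.rpow_const fun _ => Or.inr (by linarith)
  have hU : powMean (2 * p) u 1 = powMean p f 1 := by
    refine integral_congr_ae (.of_forall fun ω => ?_)
    have : ‖((1:ℝ) : ℂ) * ω‖ = 1 := by simp [Circle.norm_coe]
    simp only
    rw [Real.rpow_mul (norm_nonneg _), Real.rpow_two, (hcirc _ this).1]
  have hV : powMean (2 * p) v 1 = powMean p f 1 := by
    refine integral_congr_ae (.of_forall fun ω => ?_)
    have : ‖((1:ℝ) : ℂ) * ω‖ = 1 := by simp [Circle.norm_coe]
    simp only
    rw [Real.rpow_mul (norm_nonneg _), Real.rpow_two, (hcirc _ this).2]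
  have hUV : 2 * powMean p f t ≤ powMean (2 * p) u t + powMean (2 * p) v t := by
    rw [powMean, powMean, powMean, ← integral_const_mul, ← integral_add
      (integrable_circleMeas (hpc (hcu h0 h1.le))) (integrable_circleMeas (hpc (hcv h0 h1.le)))]
    have hle : ∀ ω : Circle, 2 * ‖f (t * ω)‖ ^ p ≤
        ‖u (t * ω)‖ ^ (2 * p) + ‖v (t * ω)‖ ^ (2 * p) := by
      intro ω
      have := mul_rpow_le_weighted (p := p) one_pos (norm_nonneg (u (t * ω)))
        (norm_nonneg (v (t * ω)))
      rw [← norm_mul, ← huv _ (hmem h0 h1.le ω)] at this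
      linarith
    refine integral_mono (integrable_circleMeas (continuous_const.mul ?_))
      (integrable_circleMeas ((hpc (hcu h0 h1.le)).add (hpc (hcv h0 h1.le)))) hle
    exact continuous_norm_rpow hp hf.continuousOn h0 (h1.trans hR)
  have hUt := powMean_mono hq hu h0 h1.le hR'
  have hVt := powMean_mono hq hv htt0 htt1.le hR'
  have hDU := powMean_sub_dilate_sq_le (by linarith) hR' hu h0 h1 (q := 2 * p)
  have hDV := powMean_sub_dilate_sq_le (by linarith) hR' hv h0 h1 (q := 2 * p)
  set X := ∫ ω : Circle, ‖u ω - u ((t * t : ℝ) * ω)‖ ^ (2 * p) ∂circleMeas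
  set Y := ∫ ω : Circle, ‖v ω - v ((t * t : ℝ) * ω)‖ ^ (2 * p) ∂circleMeas
  have hu1 : Continuous fun ω : Circle => u ω := by simpa using hcu zero_le_one le_rfl
  have hv1 : Continuous fun ω : Circle => v ω := by simpa using hcv zero_le_one le_rfl
  have c1 := hpc hu1
  have c2 := hpc (g := fun ω => v ω - v ((t * t : ℝ) * ω)) (hv1.sub (hcv htt0 htt1.le))
  have c3 := hpc (hcv htt0 htt1.le)
  have c4 := hpc (g := fun ω => u ω - u ((t * t : ℝ) * ω)) (hu1.sub (hcu htt0 htt1.le))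
  have hf1 : Continuous fun ω : Circle => f ω := by
    simpa using continuous_comp_mul_circle hf.continuousOn zero_le_one hR
  have c5 : Continuous fun ω : Circle => ‖f ω - f ((t * t : ℝ) * ω)‖ ^ p :=
    (hf1.sub (continuous_comp_mul_circle hf.continuousOn htt0 (htt1.trans hR))).norm.rpow_const
      fun _ => Or.inr (by linarith)
  have hmain : powMean p (fun z => f z - f ((t * t : ℝ) * z)) 1 ≤ 2 ^ (p - 1) *
      ((l * powMean (2 * p) u 1 + l⁻¹ * Y) / 2 +
        (l * powMean (2 * p) v (t * t) + l⁻¹ * X) / 2) := by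
    have heq : 2 ^ (p - 1) * ((l * powMean (2 * p) u 1 + l⁻¹ * Y) / 2 +
        (l * powMean (2 * p) v (t * t) + l⁻¹ * X) / 2) =
        ∫ ω : Circle, 2 ^ (p - 1) * ((l * ‖u ω‖ ^ (2 * p) +
          l⁻¹ * ‖v ω - v ((t * t : ℝ) * ω)‖ ^ (2 * p)) / 2 +
          (l * ‖v ((t * t : ℝ) * ω)‖ ^ (2 * p) +
          l⁻¹ * ‖u ω - u ((t * t : ℝ) * ω)‖ ^ (2 * p)) / 2) ∂circleMeas := by
      rw [integral_combination c1 c2 c3 c4]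
      simp only [powMean, ofReal_one, one_mul]
      rfl
    rw [heq, powMean]
    simp only [ofReal_one, one_mul]
    refine integral_mono (integrable_circleMeas c5) (integrable_circleMeas ?_) fun ω => ?_
    · fun_prop
    · have huv1 : f ω = u ω * v ω := huv ω (by simpa [Circle.norm_coe] using hR')
      simp only
      rw [huv1, huv _ (hmem htt0 htt1.le ω)]
      exact norm_mul_sub_mul_rpow_le hp hl _ _ _ _
  refine hmain.trans ?_
  rw [hU]
  rw [hV] at hVt
  have hl' : 0 < l⁻¹ := by positivity
  have hXY : X + Y ≤ 2 ^ (2 * p - 1) * (2 * powMean p f 1 - 2 * powMean p f t) := by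
    rw [hU] at hDU
    rw [hV] at hDV
    have h2 : (0:ℝ) < 2 ^ (2 * p - 1) := by positivity
    nlinarith
  refine mul_le_mul_of_nonneg_left ?_ (by positivity)
  have h3 := mul_le_mul_of_nonneg_left hVt hl.le
  have h4 := mul_le_mul_of_nonneg_left hXY hl'.le
  linarith

theorem powMean_comp_mul (p : ℝ) (f : ℂ → ℂ) (s r : ℝ) :
    powMean p (fun z => f (s * z)) r = powMean p f (s * r) := by
  simp [powMean, mul_assoc]

theorem differentiableOn_comp_mul {f : ℂ → ℂ} {R : ℝ} (hf : DifferentiableOn ℂ f (ball 0 R))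
    {s : ℝ} (hs : 0 < s) : DifferentiableOn ℂ (fun z => f (s * z)) (ball 0 (R / s)) := by
  refine hf.comp (by fun_prop) fun z hz => ?_
  rw [mem_ball_zero_iff, lt_div_iff₀ hs] at hz
  simpa [abs_of_pos hs, mul_comm] using hz

theorem exists_radius_zero_free {f : ℂ → ℂ} (hf : DifferentiableOn ℂ f (ball 0 1))
    (hne : ∃ z ∈ ball (0:ℂ) 1, f z ≠ 0) {a : ℝ} (ha : a < 1) :
    ∃ s ∈ Ioo a 1, ∀ z, ‖z‖ = s → f z ≠ 0 := by
  have hfin := finite_zeros_closedBall hf (show (a + 1) / 2 < 1 by linarith) hne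
  obtain ⟨s, hs, hs'⟩ := (Ioo_infinite (show a < (a + 1) / 2 by linarith)).exists_notMem_finite
    (hfin.image norm)
  refine ⟨s, ⟨hs.1, hs.2.trans (by linarith)⟩, fun z hz h0 => hs' ⟨z, ⟨?_, h0⟩, hz⟩⟩
  simpa [hz] using hs.2.le

/-- Dilates approximate a function with bounded integral means. -/
theorem exists_powMean_sub_dilate_le {p : ℝ} (hp : 1 ≤ p) {f : ℂ → ℂ}
    (hf : DifferentiableOn ℂ f (ball 0 1)) {B : ℝ} (hB : ∀ r ∈ Ioo (0:ℝ) 1, powMean p f r ≤ B)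
    {ε : ℝ} (hε : 0 < ε) :
    ∃ r ∈ Ioo (0:ℝ) 1, ∀ s ∈ Ioo (0:ℝ) 1, powMean p (fun z => f z - f (r * z)) s ≤ ε := by
  by_cases hne : ∃ z ∈ ball (0:ℂ) 1, f z ≠ 0
  swap
  · push Not at hne
    refine ⟨1 / 2, by norm_num, fun s hs => ?_⟩
    refine le_of_eq_of_le (integral_eq_zero_of_ae (.of_forall fun ω => ?_)) hε.le
    have h1 := hne _ (mul_circle_mem_ball hs.1.le hs.2 ω)
    have h2 := hne _ (mul_circle_mem_ball (r := 1 / 2 * s) (by linarith [hs.1])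
      (by linarith [hs.2]) ω)
    simp only [ofReal_mul, mul_assoc] at h2
    simp only [h1, h2, sub_zero, norm_zero, Pi.zero_apply]
    exact Real.zero_rpow (by linarith)
  have hB0 : 0 ≤ B := (powMean_nonneg p f (1 / 2)).trans (hB _ (by norm_num))
  set c : ℝ := 2 ^ (p - 1) with hc
  have hc0 : 0 < c := by positivity
  set d : ℝ := 2 ^ (2 * p - 1) with hd
  have hd0 : 0 < d := by positivity
  set l := ε / (2 * c * (B + 1)) with hl
  have hl0 : 0 < l := by positivity
  set η := ε * l / (2 * c * d) with hη
  have hη0 : 0 < η := by positivity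
  set M : Set ℝ := powMean p f '' Ioo 0 1 with hM
  have hMne : M.Nonempty := ⟨_, 1 / 2, by norm_num, rfl⟩
  have hMb : BddAbove M := ⟨B, by rintro _ ⟨r, hr, rfl⟩; exact hB r hr⟩
  obtain ⟨_, ⟨s₀, hs₀, rfl⟩, hs₀M⟩ := exists_lt_of_lt_csSup hMne (sub_lt_self (sSup M) hη0)
  obtain ⟨t, ht⟩ := exists_between hs₀.2
  have ht0 : 0 < t := hs₀.1.trans ht.1
  have hr1 : t * t < 1 := by nlinarith
  refine ⟨t * t, ⟨by positivity, hr1⟩, fun s hs => ?_⟩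
  obtain ⟨s', hs', hs'z⟩ := exists_radius_zero_free hf hne
    (max_lt hs.2 ((div_lt_one ht0).2 ht.1))
  have hss' : s < s' := (le_max_left _ _).trans_lt hs'.1
  have hts' : s₀ < s' * t := (div_lt_iff₀ ht0).1 ((le_max_right _ _).trans_lt hs'.1)
  have hs'0 : 0 < s' := hs.1.trans hss'
  have hdiff : DifferentiableOn ℂ (fun z => f z - f ((t * t : ℝ) * z)) (ball 0 1) := by
    refine hf.sub ((differentiableOn_comp_mul hf (by positivity)).mono (ball_subset_ball ?_))
    exact (one_le_div (by positivity)).2 hr1.le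
  refine (powMean_mono hp hdiff hs.1.le hss'.le hs'.2).trans ?_
  have key := powMean_sub_dilate_le hp hl0 ((one_lt_div hs'0).2 hs'.2)
    (differentiableOn_comp_mul hf hs'0) (fun z hz => hs'z _ (by simp [hz, abs_of_pos hs'0]))
    ht0.le ht.2
  rw [powMean_comp_mul, powMean_comp_mul, mul_one, ← hc, ← hd] at key
  have e : powMean p (fun z => f (s' * z) - f (s' * ((t * t : ℝ) * z))) 1 =
      powMean p (fun z => f z - f ((t * t : ℝ) * z)) s' := by
    simp only [powMean, ofReal_one, one_mul]
    congr! 5 with ω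
    rw [mul_left_comm]
  rw [e] at key
  refine key.trans ?_
  have h1 : powMean p f s' - powMean p f (s' * t) ≤ η := by
    have h2 : powMean p f s' ≤ sSup M := le_csSup hMb ⟨s', ⟨hs'0, hs'.2⟩, rfl⟩
    have h3 := powMean_mono hp hf hs₀.1.le hts'.le (by nlinarith [hs'.2, ht.2])
    linarith
  have h2 : c * (l * powMean p f s') ≤ ε / 2 := by
    calc c * (l * powMean p f s') ≤ c * (l * (B + 1)) := by
          gcongr
          linarith [hB s' ⟨hs'0, hs'.2⟩]
      _ = ε / 2 := by rw [hl]; field_simp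
  have h3 : c * (l⁻¹ * (d * (powMean p f s' - powMean p f (s' * t)))) ≤ ε / 2 := by
    calc c * (l⁻¹ * (d * (powMean p f s' - powMean p f (s' * t)))) ≤ c * (l⁻¹ * (d * η)) := by
          gcongr
      _ = ε / 2 := by rw [hη]; field_simp
  linarith

theorem powMean_rpow_eq_eLpNorm {p : ℝ} (hp : 1 ≤ p) {f : ℂ → ℂ} {r : ℝ}
    (hf : Continuous fun ω : Circle => f (r * ω)) :
    ENNReal.ofReal (powMean p f r ^ (1 / p)) =
      eLpNorm (fun ω : Circle => f (r * ω)) (ENNReal.ofReal p) circleMeas := by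
  have h0 : 0 < p := by linarith
  rw [MemLp.eLpNorm_eq_integral_rpow_norm (by simpa using h0) ENNReal.ofReal_ne_top
    (hf.memLp_of_hasCompactSupport (HasCompactSupport.of_compactSpace _)),
    ENNReal.toReal_ofReal h0.le, one_div, powMean]

theorem powMean_rpow_add_le {p : ℝ} (hp : 1 ≤ p) {f g : ℂ → ℂ} {r : ℝ}
    (hf : Continuous fun ω : Circle => f (r * ω)) (hg : Continuous fun ω : Circle => g (r * ω)) :
    powMean p (fun z => f z + g z) r ^ (1 / p) ≤
      powMean p f r ^ (1 / p) + powMean p g r ^ (1 / p) := by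
  have h1 : 0 ≤ powMean p f r ^ (1 / p) := Real.rpow_nonneg (powMean_nonneg _ _ _) _
  have h2 : 0 ≤ powMean p g r ^ (1 / p) := Real.rpow_nonneg (powMean_nonneg _ _ _) _
  rw [← ENNReal.ofReal_le_ofReal_iff (by positivity), ENNReal.ofReal_add h1 h2,
    powMean_rpow_eq_eLpNorm hp hf, powMean_rpow_eq_eLpNorm hp hg,
    powMean_rpow_eq_eLpNorm hp (hf.add hg)]
  exact eLpNorm_add_le hf.aestronglyMeasurable hg.aestronglyMeasurable (by simpa using hp)

theorem powMean_neg (p : ℝ) (f : ℂ → ℂ) (r : ℝ) : powMean p (fun z => -f z) r = powMean p f r := by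
  simp [powMean]

theorem powMean_le_rpow {p : ℝ} (hp : 1 ≤ p) {f : ℂ → ℂ} {r C : ℝ}
    (hf : Continuous fun ω : Circle => f (r * ω)) (hC : ∀ ω : Circle, ‖f (r * ω)‖ ≤ C) :
    powMean p f r ≤ C ^ p := by
  have h : ∀ ω : Circle, ‖f (r * ω)‖ ^ p ≤ C ^ p := fun ω =>
    Real.rpow_le_rpow (norm_nonneg _) (hC ω) (by linarith)
  refine (integral_mono (integrable_circleMeas (hf.norm.rpow_const fun _ => Or.inr (by linarith)))
    (integrable_const _) h).trans ?_
  simp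

theorem rpow_one_div_le_iff {p : ℝ} (hp : 1 ≤ p) {a b : ℝ} (ha : 0 ≤ a) (hb : 0 ≤ b) :
    a ^ (1 / p) ≤ b ↔ a ≤ b ^ p := by
  rw [one_div]
  exact Real.rpow_inv_le_iff_of_pos ha hb (by linarith)

theorem hardyNorm_eq_iSup {p : ℝ} (hp : 1 ≤ p) {f : ℂ → ℂ} (hf : DifferentiableOn ℂ f (ball 0 1)) :
    hardyNorm p f = ⨆ r : Ioo (0:ℝ) 1, powMean p f r ^ (1 / p) := by
  unfold hardyNorm
  congr 1
  ext r
  rw [mean_eq_powMean hp hf r.2]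

theorem memHp_iff {p : ℝ} (hp : 1 ≤ p) {f : ℂ → ℂ} :
    MemHp p f ↔ DifferentiableOn ℂ f (ball 0 1) ∧
      BddAbove (range fun r : Ioo (0:ℝ) 1 => powMean p f r ^ (1 / p)) := by
  refine and_congr_right fun hf => ?_
  simp_rw [fun r : Ioo (0:ℝ) 1 => mean_eq_powMean hp hf r.2]

theorem hardyNorm_nonneg {p : ℝ} (hp : 1 ≤ p) {f : ℂ → ℂ} (hf : MemHp p f) :
    0 ≤ hardyNorm p f := by
  rw [hardyNorm_eq_iSup hp hf.1]
  exact Real.iSup_nonneg fun r => Real.rpow_nonneg (powMean_nonneg _ _ _) _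

theorem powMean_rpow_le_hardyNorm {p : ℝ} (hp : 1 ≤ p) {f : ℂ → ℂ} (hf : MemHp p f) {r : ℝ}
    (hr : r ∈ Ioo (0:ℝ) 1) : powMean p f r ^ (1 / p) ≤ hardyNorm p f := by
  rw [hardyNorm_eq_iSup hp hf.1]
  exact le_ciSup ((memHp_iff hp).1 hf).2 ⟨r, hr⟩

theorem powMean_le_hardyNorm_rpow {p : ℝ} (hp : 1 ≤ p) {f : ℂ → ℂ} (hf : MemHp p f) {r : ℝ}
    (hr : r ∈ Ioo (0:ℝ) 1) : powMean p f r ≤ hardyNorm p f ^ p :=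
  (rpow_one_div_le_iff hp (powMean_nonneg _ _ _) (hardyNorm_nonneg hp hf)).1
    (powMean_rpow_le_hardyNorm hp hf hr)

theorem hardyNorm_le {p : ℝ} (hp : 1 ≤ p) {f : ℂ → ℂ} (hf : DifferentiableOn ℂ f (ball 0 1))
    {C : ℝ} (h : ∀ r ∈ Ioo (0:ℝ) 1, powMean p f r ^ (1 / p) ≤ C) : hardyNorm p f ≤ C := by
  rw [hardyNorm_eq_iSup hp hf]
  have : Nonempty (Ioo (0:ℝ) 1) := ⟨⟨1 / 2, by norm_num⟩⟩
  exact ciSup_le fun r => h r r.2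

theorem memHp_of_le {p : ℝ} (hp : 1 ≤ p) {f : ℂ → ℂ} (hf : DifferentiableOn ℂ f (ball 0 1))
    {C : ℝ} (h : ∀ r ∈ Ioo (0:ℝ) 1, powMean p f r ^ (1 / p) ≤ C) : MemHp p f := by
  refine (memHp_iff hp).2 ⟨hf, C, ?_⟩
  rintro _ ⟨r, rfl⟩
  exact h r r.2

theorem MemHp.add {p : ℝ} (hp : 1 ≤ p) {f g : ℂ → ℂ} (hf : MemHp p f) (hg : MemHp p g) :
    MemHp p fun z => f z + g z :=
  memHp_of_le hp (hf.1.add hg.1) fun _ hr =>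
    (powMean_rpow_add_le hp (continuous_comp_mul_circle hf.1.continuousOn hr.1.le hr.2)
      (continuous_comp_mul_circle hg.1.continuousOn hr.1.le hr.2)).trans
      (add_le_add (powMean_rpow_le_hardyNorm hp hf hr) (powMean_rpow_le_hardyNorm hp hg hr))

theorem hardyNorm_add_le {p : ℝ} (hp : 1 ≤ p) {f g : ℂ → ℂ} (hf : MemHp p f) (hg : MemHp p g) :
    hardyNorm p (fun z => f z + g z) ≤ hardyNorm p f + hardyNorm p g :=
  hardyNorm_le hp (hf.1.add hg.1) fun _ hr =>
    (powMean_rpow_add_le hp (continuous_comp_mul_circle hf.1.continuousOn hr.1.le hr.2)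
      (continuous_comp_mul_circle hg.1.continuousOn hr.1.le hr.2)).trans
      (add_le_add (powMean_rpow_le_hardyNorm hp hf hr) (powMean_rpow_le_hardyNorm hp hg hr))

theorem MemHp.neg {p : ℝ} (hp : 1 ≤ p) {f : ℂ → ℂ} (hf : MemHp p f) :
    MemHp p fun z => -f z :=
  memHp_of_le hp hf.1.neg fun _ hr => by
    rw [powMean_neg]
    exact powMean_rpow_le_hardyNorm hp hf hr

theorem MemHp.sub {p : ℝ} (hp : 1 ≤ p) {f g : ℂ → ℂ} (hf : MemHp p f) (hg : MemHp p g) :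
    MemHp p fun z => f z - g z := by
  simpa only [sub_eq_add_neg] using hf.add hp (hg.neg hp)

theorem hardyNorm_sub_comm {p : ℝ} (f g : ℂ → ℂ) :
    hardyNorm p (fun z => f z - g z) = hardyNorm p (fun z => g z - f z) := by
  unfold hardyNorm
  simp_rw [norm_sub_rev (f _) (g _)]

theorem hardyNorm_sub_le {p : ℝ} (hp : 1 ≤ p) {f g h : ℂ → ℂ} (hf : MemHp p f) (hg : MemHp p g)
    (hh : MemHp p h) : hardyNorm p (fun z => f z - h z) ≤
      hardyNorm p (fun z => f z - g z) + hardyNorm p (fun z => g z - h z) := by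
  simpa using hardyNorm_add_le hp (hf.sub hp hg) (hg.sub hp hh)

theorem hardyNorm_sub_self {p : ℝ} (hp : 1 ≤ p) {f : ℂ → ℂ} (hf : MemHp p f) :
    hardyNorm p (fun z => f z - f z) = 0 := by
  refine le_antisymm (hardyNorm_le hp (hf.sub hp hf).1 fun r _ => ?_)
    (hardyNorm_nonneg hp (hf.sub hp hf))
  have h : powMean p (fun z => f z - f z) r = 0 := by
    simp [powMean, Real.zero_rpow (show p ≠ 0 by linarith)]
  rw [h, Real.zero_rpow (one_div_ne_zero (by linarith))]

/-- Point evaluations are locally uniformly bounded on `H^p`. -/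
theorem exists_norm_le_mul_hardyNorm {p : ℝ} (hp : 1 ≤ p) {R : ℝ} (hR0 : 0 < R) (hR : R < 1) :
    ∃ C : ℝ, 0 < C ∧ ∀ f : ℂ → ℂ, MemHp p f → ∀ z ∈ closedBall (0:ℂ) R,
      ‖f z‖ ≤ C * hardyNorm p f := by
  set s := (1 + R) / 2 with hs
  have hs0 : 0 < s := by positivity
  have hRs : R < s := by linarith
  have hs1 : s < 1 := by linarith
  have hd : 0 < 1 - R / s := by rw [sub_pos, div_lt_one hs0]; exact hRs
  refine ⟨(2 / (1 - R / s)) ^ (1 / p), by positivity, fun f hf z hz => ?_⟩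
  rw [mem_closedBall_zero_iff] at hz
  have hN := hardyNorm_nonneg hp hf
  have h1 : ‖f z‖ ^ p ≤ 2 / (1 - R / s) * hardyNorm p f ^ p := by
    refine (norm_rpow_le_powMean hp hf.1 hs0 hs1 (hz.trans_lt hRs)).trans ?_
    have := powMean_nonneg p f s
    gcongr
    exact powMean_le_hardyNorm_rpow hp hf ⟨hs0, hs1⟩
  have h0 : 0 < p := by linarith
  rw [← Real.rpow_le_rpow_iff (norm_nonneg _) (by positivity) h0,
    Real.mul_rpow (by positivity) hN, ← Real.rpow_mul (by positivity), one_div_mul_cancel h0.ne',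
    Real.rpow_one]
  exact h1

/-- The pseudometric of the Hardy norm. -/
@[reducible]
def hpPseudoMetricSpace {p : ℝ} (hp : 1 ≤ p) : PseudoMetricSpace (HpSpace p) :=
  PseudoMetricSpace.ofDistTopology (fun f g => hardyNorm p fun z => f.1 z - g.1 z)
    (fun f => hardyNorm_sub_self hp f.2)
    (fun f g => hardyNorm_sub_comm _ _)
    (fun f g h => hardyNorm_sub_le hp f.2 g.2 h.2)
    (fun s => by
      constructor
      · intro hs
        induction hs with
        | basic U hU =>
          obtain ⟨f, ε, hε, rfl⟩ := hU
          intro g hg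
          refine ⟨ε - hardyNorm p fun z => g.1 z - f.1 z, sub_pos.2 hg, fun h hh => ?_⟩
          have h1 := hardyNorm_sub_le hp h.2 g.2 f.2
          rw [hardyNorm_sub_comm h.1 g.1] at h1
          have : hardyNorm p (fun z => h.1 z - f.1 z) < ε := by linarith
          exact this
        | univ => exact fun _ _ => ⟨1, one_pos, fun _ _ => trivial⟩
        | inter U V _ _ hU hV =>
          intro f hf
          obtain ⟨ε, hε, h1⟩ := hU f hf.1
          obtain ⟨δ, hδ, h2⟩ := hV f hf.2
          exact ⟨min ε δ, lt_min hε hδ, fun g hg =>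
            ⟨h1 g (hg.trans_le (min_le_left _ _)), h2 g (hg.trans_le (min_le_right _ _))⟩⟩
        | sUnion S _ hS =>
          rintro f ⟨U, hU, hf⟩
          obtain ⟨ε, hε, h1⟩ := hS U hU f hf
          exact ⟨ε, hε, fun g hg => ⟨U, hU, h1 g hg⟩⟩
      · intro h
        refine isOpen_iff_forall_mem_open.2 fun f hf => ?_
        obtain ⟨ε, hε, h1⟩ := h f hf
        refine ⟨{g : HpSpace p | hardyNorm p (fun z => g.1 z - f.1 z) < ε}, fun g hg => h1 g ?_,
          .basic _ ⟨f, ε, hε, rfl⟩, ?_⟩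
        · rw [hardyNorm_sub_comm]
          exact hg
        · exact (hardyNorm_sub_self hp f.2).trans_lt hε)

theorem exists_closedBall_of_isCompact {L : Set ℂ} (hL : IsCompact L) (hL1 : L ⊆ ball (0:ℂ) 1) :
    ∃ R : ℝ, 0 < R ∧ R < 1 ∧ L ⊆ closedBall (0:ℂ) R := by
  obtain ⟨R, hR, hLR⟩ := exists_pos_lt_subset_ball (x := (0:ℂ)) one_pos hL.isClosed hL1
  exact ⟨R, hR.1, hR.2, hLR.trans ball_subset_closedBall⟩

theorem tendsto_hardyNorm_of_cauchy {p : ℝ} (hp : 1 ≤ p) {u : ℕ → ℂ → ℂ} (hu : ∀ n, MemHp p (u n))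
    (hc : ∀ ε > 0, ∃ N, ∀ m ≥ N, ∀ n ≥ N, hardyNorm p (fun z => u m z - u n z) < ε) :
    ∃ F : ℂ → ℂ, MemHp p F ∧ ∀ ε > 0, ∃ N, ∀ n ≥ N, hardyNorm p (fun z => u n z - F z) ≤ ε := by
  have hunif : ∀ R : ℝ, 0 < R → R < 1 → UniformCauchySeqOn u atTop (closedBall 0 R) := by
    intro R hR0 hR1
    obtain ⟨C, hC0, hC⟩ := exists_norm_le_mul_hardyNorm hp hR0 hR1
    rw [Metric.uniformCauchySeqOn_iff]
    intro ε hε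
    obtain ⟨N, hN⟩ := hc (ε / C) (by positivity)
    refine ⟨N, fun m hm n hn z hz => ?_⟩
    rw [dist_eq_norm]
    refine (hC _ ((hu m).sub hp (hu n)) z hz).trans_lt ?_
    rw [mul_comm, ← lt_div_iff₀ hC0]
    exact hN m hm n hn
  have hpt : ∀ z ∈ ball (0:ℂ) 1, ∃ w, Tendsto (fun n => u n z) atTop (𝓝 w) := by
    intro z hz
    obtain ⟨R, hzR, hR1⟩ := exists_between (mem_ball_zero_iff.1 hz)
    exact cauchySeq_tendsto_of_complete
      ((hunif R ((norm_nonneg z).trans_lt hzR) hR1).cauchySeq (by simpa using hzR.le))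
  choose! F hF using hpt
  have hUF : ∀ R : ℝ, 0 < R → R < 1 → TendstoUniformlyOn u F atTop (closedBall 0 R) :=
    fun R hR0 hR1 => (hunif R hR0 hR1).tendstoUniformlyOn_of_tendsto
      fun z hz => hF z (closedBall_subset_ball hR1 hz)
  have hFd : DifferentiableOn ℂ F (ball 0 1) := by
    have hloc : TendstoLocallyUniformlyOn u F atTop (ball 0 1) := by
      refine (tendstoLocallyUniformlyOn_iff_forall_isCompact isOpen_ball).2 fun L hL hLc => ?_
      obtain ⟨R, hR0, hR1, hLR⟩ := exists_closedBall_of_isCompact hLc hL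
      exact (hUF R hR0 hR1).mono hLR
    exact hloc.differentiableOn (.of_forall fun n => (hu n).1) isOpen_ball
  have key : ∀ ε > 0, ∃ N, ∀ n ≥ N, ∀ r ∈ Ioo (0:ℝ) 1,
      powMean p (fun z => u n z - F z) r ^ (1 / p) ≤ ε := by
    intro ε hε
    obtain ⟨N, hN⟩ := hc ε hε
    refine ⟨N, fun n hn r hr => le_of_forall_pos_le_add fun δ hδ => ?_⟩
    obtain ⟨m, hm, hmN⟩ := ((Metric.tendstoUniformlyOn_iff.1 (hUF r hr.1 hr.2) δ hδ).and
      (eventually_ge_atTop N)).exists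
    have hcont {g : ℂ → ℂ} (hg : DifferentiableOn ℂ g (ball 0 1)) :=
      continuous_comp_mul_circle hg.continuousOn hr.1.le hr.2
    have h1 := powMean_rpow_add_le hp (hcont ((hu n).1.sub (hu m).1)) (hcont ((hu m).1.sub hFd))
    simp only [sub_add_sub_cancel, Pi.sub_apply] at h1
    refine h1.trans (add_le_add ?_ ?_)
    · exact (powMean_rpow_le_hardyNorm hp ((hu n).sub hp (hu m)) hr).trans (hN n hn m hmN).le
    · rw [rpow_one_div_le_iff hp (powMean_nonneg _ _ _) hδ.le]
      refine powMean_le_rpow hp (hcont ((hu m).1.sub hFd)) fun ω => ?_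
      rw [Pi.sub_apply, ← dist_eq_norm, dist_comm]
      exact (hm _ (by simp [Circle.norm_coe, abs_of_pos hr.1])).le
  obtain ⟨N, hN⟩ := key 1 one_pos
  have hsub : MemHp p fun z => u N z - F z := memHp_of_le hp ((hu N).1.sub hFd) (hN N le_rfl)
  have hFm : MemHp p F := by simpa using (hu N).sub hp hsub
  refine ⟨F, hFm, fun ε hε => ?_⟩
  obtain ⟨N, hN⟩ := key ε hε
  exact ⟨N, fun n hn => hardyNorm_le hp ((hu n).1.sub hFd) (hN n hn)⟩

theorem baireSpace_hpSpace {p : ℝ} (hp : 1 ≤ p) : BaireSpace (HpSpace p) := by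
  let _ : PseudoMetricSpace (HpSpace p) := hpPseudoMetricSpace hp
  have : CompleteSpace (HpSpace p) := by
    refine Metric.complete_of_cauchySeq_tendsto fun u hu => ?_
    obtain ⟨F, hF, hlim⟩ := tendsto_hardyNorm_of_cauchy hp (fun n => (u n).2)
      fun ε hε => Metric.cauchySeq_iff.1 hu ε hε
    refine ⟨⟨F, hF⟩, Metric.tendsto_atTop.2 fun ε hε => ?_⟩
    obtain ⟨N, hN⟩ := hlim (ε / 2) (by positivity)
    exact ⟨N, fun n hn => (hN n hn).trans_lt (by linarith)⟩
  infer_instance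

/-- Trigonometric polynomials are uniformly dense in the continuous functions on the circle. -/
theorem exists_trig_approx {τ : ℂ → ℂ} (hτ : Continuous τ) {ε : ℝ} (hε : 0 < ε) :
    ∃ (N : ℕ) (Q : ℂ[X]), ∀ z : ℂ, ‖z‖ = 1 →
      ‖Q.eval z * starRingEnd ℂ z ^ N - τ z‖ < ε := by
  have hmain : ∀ g ∈ (polynomialFunctions (sphere (0:ℂ) 1)).starClosure,
      ∃ (N : ℕ) (Q : ℂ[X]), ∀ z : sphere (0:ℂ) 1, g z = Q.eval (z:ℂ) * starRingEnd ℂ (z:ℂ) ^ N := by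
    intro g hg
    have hone : ∀ z : sphere (0:ℂ) 1, (z:ℂ) * starRingEnd ℂ (z:ℂ) = 1 := by
      intro z
      rw [mul_conj, normSq_eq_norm_sq, mem_sphere_zero_iff_norm.1 z.2]
      simp
    rw [polynomialFunctions.starClosure_eq_adjoin_X, ← StarSubalgebra.mem_toSubalgebra,
      StarAlgebra.adjoin_toSubalgebra] at hg
    induction hg using Algebra.adjoin_induction with
    | mem x hx =>
      rcases hx with hx | hx
      · rw [Set.mem_singleton_iff] at hx
        exact ⟨0, X, fun z => by simp [hx]⟩
      · rw [Set.mem_star, Set.mem_singleton_iff, star_eq_iff_star_eq] at hx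
        exact ⟨1, 1, fun z => by simp [← hx]⟩
    | algebraMap c => exact ⟨0, C c, fun z => by simp [Algebra.algebraMap_eq_smul_one]⟩
    | add x y _ _ hx hy =>
      obtain ⟨N, Q, hQ⟩ := hx
      obtain ⟨M, P, hP⟩ := hy
      refine ⟨N + M, Q * X ^ M + P * X ^ N, fun z => ?_⟩
      have h1 : (z:ℂ) ^ M * starRingEnd ℂ (z:ℂ) ^ M = 1 := by rw [← mul_pow, hone, one_pow]
      have h2 : (z:ℂ) ^ N * starRingEnd ℂ (z:ℂ) ^ N = 1 := by rw [← mul_pow, hone, one_pow]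
      rw [ContinuousMap.add_apply, hQ, hP]
      simp only [eval_add, eval_mul, eval_pow, eval_X, pow_add]
      linear_combination (-(Q.eval (z:ℂ)) * starRingEnd ℂ (z:ℂ) ^ N) * h1 -
        (P.eval (z:ℂ) * starRingEnd ℂ (z:ℂ) ^ M) * h2
    | mul x y _ _ hx hy =>
      obtain ⟨N, Q, hQ⟩ := hx
      obtain ⟨M, P, hP⟩ := hy
      refine ⟨N + M, Q * P, fun z => ?_⟩
      rw [ContinuousMap.mul_apply, hQ, hP, eval_mul, pow_add]
      ring
  have hmem : (⟨fun z => τ z, by fun_prop⟩ : C(sphere (0:ℂ) 1, ℂ)) ∈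
      (polynomialFunctions (sphere (0:ℂ) 1)).starClosure.topologicalClosure := by
    rw [polynomialFunctions.starClosure_topologicalClosure]
    trivial
  obtain ⟨g, hg, hgd⟩ := Metric.mem_closure_iff.1 hmem ε hε
  obtain ⟨N, Q, hQ⟩ := hmain g hg
  refine ⟨N, Q, fun z hz => ?_⟩
  have := (ContinuousMap.dist_lt_iff hε).1 hgd ⟨z, mem_sphere_zero_iff_norm.2 hz⟩
  rwa [hQ, dist_comm, dist_eq_norm] at this

theorem exists_re_eq_trig (Q : ℂ[X]) (N : ℕ) :
    ∃ H : ℂ[X], ∀ z : ℂ, ‖z‖ = 1 → (Q.eval z * starRingEnd ℂ z ^ N).re = (H.eval z).re := by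
  induction Q using Polynomial.induction_on' with
  | add P Q hP hQ =>
    obtain ⟨G, hG⟩ := hP
    obtain ⟨H, hH⟩ := hQ
    exact ⟨G + H, fun z hz => by rw [eval_add, eval_add, add_mul, add_re, add_re, hG z hz, hH z hz]⟩
  | monomial k c =>
    have hone : ∀ z : ℂ, ‖z‖ = 1 → z * starRingEnd ℂ z = 1 := by
      intro z hz
      rw [mul_conj, normSq_eq_norm_sq, hz]
      simp
    rcases le_total N k with h | h
    · obtain ⟨d, rfl⟩ := Nat.exists_eq_add_of_le h
      refine ⟨monomial d c, fun z hz => ?_⟩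
      rw [eval_monomial, eval_monomial, pow_add]
      have : c * (z ^ N * z ^ d) * starRingEnd ℂ z ^ N = c * z ^ d * (z * starRingEnd ℂ z) ^ N := by
        ring
      rw [this, hone z hz, one_pow, mul_one]
    · obtain ⟨d, rfl⟩ := Nat.exists_eq_add_of_le h
      refine ⟨monomial d (starRingEnd ℂ c), fun z hz => ?_⟩
      rw [eval_monomial, eval_monomial, pow_add]
      have : c * z ^ k * (starRingEnd ℂ z ^ k * starRingEnd ℂ z ^ d) =
          c * starRingEnd ℂ z ^ d * (z * starRingEnd ℂ z) ^ k := by ring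
      rw [this, hone z hz, one_pow, mul_one, ← conj_re]
      simp

/-- Real parts of polynomials are uniformly dense in the real continuous functions on the circle. -/
theorem exists_re_polynomial_approx {u : ℂ → ℝ} (hu : Continuous u) {ε : ℝ} (hε : 0 < ε) :
    ∃ H : ℂ[X], ∀ z : ℂ, ‖z‖ = 1 → |(H.eval z).re - u z| < ε := by
  obtain ⟨N, Q, hQ⟩ := exists_trig_approx (τ := fun z => (u z : ℂ)) (by fun_prop) hε
  obtain ⟨H, hH⟩ := exists_re_eq_trig Q N
  refine ⟨H, fun z hz => ?_⟩
  rw [← hH z hz]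
  refine lt_of_le_of_lt ?_ (hQ z hz)
  simpa using abs_re_le_norm (Q.eval z * starRingEnd ℂ z ^ N - (u z : ℂ))

theorem circleMeas_eq_zero {K : Set ℂ} (hK : IsClosed K) (h : arcMeasure K = 0) :
    circleMeas {ω : Circle | (ω : ℂ) ∈ K} = 0 := by
  have hm : MeasurableSet {ω : Circle | (ω : ℂ) ∈ K} :=
    (hK.preimage (f := fun ω : Circle => (ω : ℂ)) (by fun_prop)).measurableSet
  rw [circleMeas, Measure.map_apply Circle.exp.continuous.measurable hm, Measure.smul_apply,
    ← Measure.restrict_congr_set Ico_ae_eq_Ioc, Measure.restrict_apply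
    (Circle.exp.continuous.measurable hm), smul_eq_mul, mul_eq_zero]
  right
  refine measure_mono_null (fun θ hθ => ?_) h
  refine ⟨hθ.2, ?_⟩
  simpa using hθ.1

theorem exists_continuous_small_sq_integral {K : Set ℂ} (hKc : IsClosed K) (hne : K.Nonempty)
    (hKm : arcMeasure K = 0) {A : ℝ} (hA : 0 < A) {η : ℝ} (hη : 0 < η) :
    ∃ u : ℂ → ℝ, Continuous u ∧ (∀ z, 0 ≤ u z) ∧ (∀ z ∈ K, u z = A) ∧
      ∫ ω : Circle, u ω ^ 2 ∂circleMeas < η := by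
  set v : ℕ → ℂ → ℝ := fun n z => A / (1 + n * infDist z K) with hv
  have hpos : ∀ (n : ℕ) z, 0 < 1 + n * infDist z K := fun n z => by
    have := infDist_nonneg (x := z) (s := K)
    positivity
  have hvc : ∀ n, Continuous (v n) := fun n =>
    continuous_const.div (continuous_const.add (continuous_const.mul (continuous_infDist_pt K)))
      fun z => (hpos n z).ne'
  have hv0 : ∀ n z, 0 ≤ v n z := fun n z => div_nonneg hA.le (hpos n z).le
  have hvA : ∀ n z, v n z ≤ A := fun n z => by
    refine div_le_self hA.le ?_
    have := infDist_nonneg (x := z) (s := K)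
    have : 0 ≤ n * infDist z K := by positivity
    linarith
  have hlim : Tendsto (fun n => ∫ ω : Circle, v n ω ^ 2 ∂circleMeas) atTop (𝓝 0) := by
    have h0 : ∫ _ : Circle, (0:ℝ) ∂circleMeas = 0 := integral_zero _ _
    rw [← h0]
    refine tendsto_integral_of_dominated_convergence (fun _ => A ^ 2) (fun n => ?_)
      (integrable_const _) (fun n => .of_forall fun ω => ?_) ?_
    · exact (((hvc n).comp (by fun_prop : Continuous fun ω : Circle => (ω : ℂ))).pow 2).aestronglyMeasurable
    · rw [Real.norm_eq_abs, abs_of_nonneg (sq_nonneg _)]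
      exact pow_le_pow_left₀ (hv0 n _) (hvA n _) 2
    · have hae : ∀ᵐ ω : Circle ∂circleMeas, (ω:ℂ) ∉ K := by
        rw [ae_iff]
        simpa using circleMeas_eq_zero hKc hKm
      filter_upwards [hae] with ω hω
      have hd : 0 < infDist (ω:ℂ) K := (hKc.notMem_iff_infDist_pos hne).1 hω
      have h1 : Tendsto (fun n : ℕ => 1 + n * infDist (ω:ℂ) K) atTop atTop :=
        tendsto_atTop_add_const_left _ _ (tendsto_natCast_atTop_atTop.atTop_mul_const hd)
      simpa using (h1.const_div_atTop A).pow 2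
  obtain ⟨n, hn⟩ := (hlim.eventually (gt_mem_nhds hη)).exists
  refine ⟨v n, hvc n, hv0 n, fun z hz => ?_, hn⟩
  simp [hv, infDist_zero_of_mem hz]

theorem integral_circleMeas_eq_apply_zero {f : ℂ → ℂ} (hf : Differentiable ℂ f) :
    ∫ ω : Circle, f ω ∂circleMeas = f 0 := by
  rw [integral_circleMeas_eq_circleAverage (hf.continuous.comp (by fun_prop))]
  exact DiffContOnCl.circleAverage hf.diffContOnCl

/-- The real and imaginary parts of a holomorphic function vanishing at `0` have the same norm. -/
theorem integral_norm_sq_eq_two_mul {f : ℂ → ℂ} (hf : Differentiable ℂ f) (h0 : f 0 = 0) :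
    ∫ ω : Circle, ‖f ω‖ ^ 2 ∂circleMeas = 2 * ∫ ω : Circle, (f ω).re ^ 2 ∂circleMeas := by
  have hc : Continuous fun ω : Circle => f ω := hf.continuous.comp (by fun_prop)
  have hre : Continuous fun ω : Circle => (f ω).re := continuous_re.comp hc
  have hsq : Continuous fun ω : Circle => f ω ^ 2 := hc.pow 2
  have hsqre : Continuous fun ω : Circle => (f ω ^ 2).re := continuous_re.comp hsq
  have hre2 : Continuous fun ω : Circle => 2 * (f ω).re ^ 2 := continuous_const.mul (hre.pow 2)
  have h1 : ∫ ω : Circle, (f ω ^ 2).re ∂circleMeas = 0 := by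
    have h2 := integral_re (𝕜 := ℂ) (integrable_circleMeas hsq)
    rw [integral_circleMeas_eq_apply_zero (f := fun z => f z ^ 2) (by fun_prop), h0] at h2
    simpa using h2
  have h3 : ∀ ω : Circle, ‖f ω‖ ^ 2 = 2 * (f ω).re ^ 2 - (f ω ^ 2).re := fun ω => by
    rw [← normSq_eq_norm_sq, normSq_apply, sq (f ω), mul_re]
    ring
  simp_rw [h3]
  rw [integral_sub (integrable_circleMeas hre2) (integrable_circleMeas hsqre), h1, sub_zero,
    integral_const_mul]

theorem exists_polynomial_large_re {K : Set ℂ} (hKc : IsClosed K) (hne : K.Nonempty)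
    (hKT : K ⊆ sphere 0 1) (hKm : arcMeasure K = 0) {A : ℝ} (hA : 0 < A) {η : ℝ} (hη : 0 < η) :
    ∃ H : ℂ[X], H.eval 0 = 0 ∧ (∀ z, ‖z‖ = 1 → -1 ≤ (H.eval z).re) ∧
      (∀ z ∈ K, A ≤ (H.eval z).re) ∧ ∫ ω : Circle, ‖H.eval (ω : ℂ)‖ ^ 2 ∂circleMeas ≤ η := by
  set κ := min (η / 8) (1 / 16) with hκ
  have hκ0 : 0 < κ := by positivity
  have hκη : κ ≤ η / 8 := min_le_left _ _
  have hκ1 : κ ≤ 1 / 16 := min_le_right _ _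
  obtain ⟨u, huc, hu0, huK, hui⟩ :=
    exists_continuous_small_sq_integral hKc hne hKm (A := A + 1) (by linarith) hκ0
  obtain ⟨G, hG⟩ := exists_re_polynomial_approx huc hκ0
  have hGc : Continuous fun ω : Circle => (G.eval (ω : ℂ)).re := by
    have : Continuous fun z : ℂ => G.eval z := G.continuous
    exact continuous_re.comp (this.comp (by fun_prop))
  have huc' : Continuous fun ω : Circle => u ω := huc.comp (by fun_prop)
  have hω : ∀ ω : Circle, ‖(ω : ℂ)‖ = 1 := Circle.norm_coe
  have hmean : ∫ ω : Circle, (G.eval (ω : ℂ)).re ∂circleMeas = (G.eval 0).re := by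
    have h1 := integral_re (𝕜 := ℂ) (μ := circleMeas) (f := fun ω : Circle => G.eval (ω : ℂ))
      (integrable_circleMeas (G.continuous.comp (by fun_prop)))
    rw [integral_circleMeas_eq_apply_zero G.differentiable] at h1
    exact h1
  set m := (G.eval 0).re with hm
  have hsq : ∫ ω : Circle, (G.eval (ω : ℂ)).re ^ 2 ∂circleMeas ≤ 2 * κ + 2 * κ ^ 2 := by
    calc ∫ ω : Circle, (G.eval (ω : ℂ)).re ^ 2 ∂circleMeas
        ≤ ∫ ω : Circle, (2 * u ω ^ 2 + 2 * κ ^ 2) ∂circleMeas := by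
          refine integral_mono (integrable_circleMeas (hGc.pow 2))
            (integrable_circleMeas (by fun_prop)) fun ω => ?_
          have h1 := abs_lt.1 (hG ω (hω ω))
          have h2 : ((G.eval (ω : ℂ)).re - u ω) ^ 2 ≤ κ ^ 2 := by
            rw [sq_le_sq, abs_of_pos hκ0]
            exact (hG ω (hω ω)).le
          simp only
          nlinarith [sq_nonneg ((G.eval (ω : ℂ)).re - u ω - u ω)]
      _ ≤ 2 * κ + 2 * κ ^ 2 := by
          rw [integral_add (integrable_circleMeas (by fun_prop)) (integrable_const _),
            integral_const_mul]
          simp only [integral_const, probReal_univ, one_smul]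
          linarith
  have hvar : ∫ ω : Circle, ((G.eval (ω : ℂ)).re - m) ^ 2 ∂circleMeas =
      ∫ ω : Circle, (G.eval (ω : ℂ)).re ^ 2 ∂circleMeas - m ^ 2 := by
    have h1 : ∀ ω : Circle, ((G.eval (ω : ℂ)).re - m) ^ 2 =
        (G.eval (ω : ℂ)).re ^ 2 - (2 * m * (G.eval (ω : ℂ)).re - m ^ 2) := fun ω => by ring
    have c1 : Continuous fun ω : Circle => (G.eval (ω : ℂ)).re ^ 2 := hGc.pow 2
    have c2 : Continuous fun ω : Circle => 2 * m * (G.eval (ω : ℂ)).re := continuous_const.mul hGc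
    have c3 : Continuous fun ω : Circle => 2 * m * (G.eval (ω : ℂ)).re - m ^ 2 :=
      c2.sub continuous_const
    simp_rw [h1]
    rw [integral_sub (integrable_circleMeas c1) (integrable_circleMeas c3),
      integral_sub (integrable_circleMeas c2) (integrable_const _), integral_const_mul,
      hmean]
    simp only [integral_const, probReal_univ, one_smul]
    ring
  have hvar0 : 0 ≤ ∫ ω : Circle, ((G.eval (ω : ℂ)).re - m) ^ 2 ∂circleMeas :=
    integral_nonneg fun _ => sq_nonneg _
  have hm1 : |m| ≤ 1 / 2 := by
    rw [← abs_of_pos (show (0:ℝ) < 1 / 2 by norm_num), ← sq_le_sq]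
    nlinarith
  have hm2 := abs_le.1 hm1
  refine ⟨G - C (G.eval 0), by simp, fun z hz => ?_, fun z hz => ?_, ?_⟩
  · have h1 := abs_lt.1 (hG z hz)
    have h2 := hu0 z
    simp only [eval_sub, eval_C, sub_re]
    linarith
  · have h1 := abs_lt.1 (hG z (mem_sphere_zero_iff_norm.1 (hKT hz)))
    rw [huK z hz] at h1
    simp only [eval_sub, eval_C, sub_re]
    linarith
  · rw [integral_norm_sq_eq_two_mul (f := fun z => (G - C (G.eval 0)).eval z)
      (Polynomial.differentiable _) (by simp)]
    simp only [eval_sub, eval_C, sub_re]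
    rw [← hm, hvar]
    nlinarith [sq_nonneg m]

theorem norm_one_sub_exp_neg_le {w : ℂ} (hw : -1 ≤ w.re) : ‖1 - Complex.exp (-w)‖ ≤ 4 := by
  refine (norm_sub_le _ _).trans ?_
  rw [norm_one, norm_exp, neg_re]
  have h1 : Real.exp (-w.re) ≤ Real.exp 1 := Real.exp_le_exp.2 (by linarith)
  linarith [Real.exp_one_lt_d9]

theorem norm_one_sub_exp_neg_le_mul {w : ℂ} (hw : -1 ≤ w.re) :
    ‖1 - Complex.exp (-w)‖ ≤ 4 * ‖w‖ := by
  rcases le_total ‖w‖ 1 with h | h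
  · have := norm_exp_sub_one_le (x := -w) (by simpa using h)
    rw [norm_sub_rev, norm_neg] at this
    linarith [norm_nonneg w]
  · linarith [norm_one_sub_exp_neg_le hw]

/-- A null compact subset of the circle carries peak functions that are small in `L^p`. -/
theorem exists_peak {p : ℝ} (hp : 1 ≤ p) {K : Set ℂ} (hKc : IsClosed K) (hne : K.Nonempty)
    (hKT : K ⊆ sphere 0 1) (hKm : arcMeasure K = 0) {ε η : ℝ} (hε : 0 < ε) (hη : 0 < η) :
    ∃ q : ℂ → ℂ, Differentiable ℂ q ∧ q 0 = 0 ∧ (∀ z, ‖z‖ = 1 → ‖q z‖ ≤ 4) ∧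
      (∀ z ∈ K, ‖q z - 1‖ < ε) ∧ powMean p q 1 ≤ η := by
  have hp0 : 0 < p := by linarith
  set δ := (η / 2) ^ (1 / p) with hδ
  have hδ0 : 0 < δ := by positivity
  have hδp : δ ^ p = η / 2 := by
    rw [hδ, ← Real.rpow_mul (by positivity), one_div_mul_cancel hp0.ne', Real.rpow_one]
  set X := η / 2 * (δ ^ 2 / (4 ^ p * 16)) with hX
  have hX0 : 0 < X := by positivity
  obtain ⟨A, hA0, hA⟩ : ∃ A : ℝ, 0 < A ∧ Real.exp (-A) < ε := by
    have h := (Real.tendsto_exp_neg_atTop_nhds_zero.eventually (gt_mem_nhds hε)).and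
      (eventually_gt_atTop 0)
    obtain ⟨A, hA⟩ := h.exists
    exact ⟨A, hA.2, hA.1⟩
  obtain ⟨H, hH0, hH1, hHK, hHi⟩ := exists_polynomial_large_re hKc hne hKT hKm hA0 hX0
  have hHd : Differentiable ℂ fun z => H.eval z := H.differentiable
  have hqd : Differentiable ℂ fun z => 1 - Complex.exp (-H.eval z) := by fun_prop
  refine ⟨fun z => 1 - Complex.exp (-H.eval z), hqd, by simp [hH0],
    fun z hz => norm_one_sub_exp_neg_le (hH1 z hz), fun z hz => ?_, ?_⟩
  · rw [sub_sub_cancel_left, norm_neg, norm_exp, neg_re]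
    exact (Real.exp_le_exp.2 (neg_le_neg (hHK z hz))).trans_lt hA
  · have hpt : ∀ ω : Circle, ‖1 - Complex.exp (-H.eval (ω : ℂ))‖ ^ p ≤
        δ ^ p + 4 ^ p * 16 / δ ^ 2 * ‖H.eval (ω : ℂ)‖ ^ 2 := by
      intro ω
      have h1 := hH1 ω (Circle.norm_coe ω)
      have h4 := norm_one_sub_exp_neg_le h1
      have h5 := norm_one_sub_exp_neg_le_mul h1
      set x := ‖1 - Complex.exp (-H.eval (ω : ℂ))‖
      have hx0 : 0 ≤ x := norm_nonneg _
      rcases le_total x δ with h | h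
      · have := Real.rpow_le_rpow hx0 h hp0.le
        have h6 : 0 ≤ 4 ^ p * 16 / δ ^ 2 * ‖H.eval (ω : ℂ)‖ ^ 2 := by positivity
        linarith
      · have h6 := Real.rpow_le_rpow hx0 h4 hp0.le
        have h7 : δ ^ 2 ≤ 16 * ‖H.eval (ω : ℂ)‖ ^ 2 := by
          have := pow_le_pow_left₀ hδ0.le (h.trans h5) 2
          linarith
        have h8 : 1 ≤ 16 * ‖H.eval (ω : ℂ)‖ ^ 2 / δ ^ 2 := (one_le_div (by positivity)).2 h7
        have h9 : (4:ℝ) ^ p ≤ 4 ^ p * (16 * ‖H.eval (ω : ℂ)‖ ^ 2 / δ ^ 2) :=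
          le_mul_of_one_le_right (by positivity) h8
        have h10 : 0 ≤ δ ^ p := by positivity
        calc x ^ p ≤ 4 ^ p * (16 * ‖H.eval (ω : ℂ)‖ ^ 2 / δ ^ 2) := h6.trans h9
          _ = 4 ^ p * 16 / δ ^ 2 * ‖H.eval (ω : ℂ)‖ ^ 2 := by ring
          _ ≤ _ := by linarith
    have hHc : Continuous fun ω : Circle => H.eval (ω : ℂ) := H.continuous.comp (by fun_prop)
    have hqc : Continuous fun ω : Circle => 1 - Complex.exp (-H.eval (ω : ℂ)) := by fun_prop
    rw [powMean]
    simp only [ofReal_one, one_mul]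
    refine (integral_mono (integrable_circleMeas (hqc.norm.rpow_const fun _ => Or.inr hp0.le))
      (integrable_circleMeas (by fun_prop)) hpt).trans ?_
    rw [integral_add (integrable_const _) (integrable_circleMeas (by fun_prop)),
      integral_const_mul]
    simp only [integral_const, probReal_univ, one_smul]
    have h11 : 4 ^ p * 16 / δ ^ 2 * ∫ ω : Circle, ‖H.eval (ω : ℂ)‖ ^ 2 ∂circleMeas ≤
        4 ^ p * 16 / δ ^ 2 * X := by gcongr
    have h12 : 4 ^ p * 16 / δ ^ 2 * X = η / 2 := by
      rw [hX]
      field_simp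
    linarith

/-- Continuous data on a null compact subset of the circle are interpolated approximately by
entire functions that are small in `H^p`. -/
theorem exists_entire_approx {p : ℝ} (hp : 1 ≤ p) {K : Set ℂ} (hKc : IsCompact K)
    (hKT : K ⊆ sphere 0 1) (hKm : arcMeasure K = 0) {ψ : ℂ → ℂ} (hψ : ContinuousOn ψ K)
    {ε η : ℝ} (hε : 0 < ε) (hη : 0 < η) :
    ∃ h : ℂ → ℂ, Differentiable ℂ h ∧ (∀ z ∈ K, ‖h z - ψ z‖ < ε) ∧ powMean p h 1 ≤ η := by
  have hp0 : 0 < p := by linarith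
  rcases K.eq_empty_or_nonempty with rfl | hne
  · refine ⟨fun _ => 0, by fun_prop, by simp, ?_⟩
    simp [powMean, Real.zero_rpow hp0.ne', hη.le]
  obtain ⟨g, hg⟩ := ContinuousMap.exists_restrict_eq hKc.isClosed
    (⟨K.domRestrict ψ, hψ.domRestrict⟩ : C(K, ℂ))
  have hgK : ∀ z ∈ K, g z = ψ z := fun z hz => DFunLike.congr_fun hg ⟨z, hz⟩
  obtain ⟨N, Q, hQ⟩ := exists_trig_approx g.continuous (half_pos hε)
  obtain ⟨B, hB⟩ := (isCompact_sphere (0:ℂ) 1).exists_bound_of_continuousOn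
    (f := fun z => Q.eval z) Q.continuous.continuousOn
  have hB0 : 0 ≤ B := (norm_nonneg _).trans (hB 1 (by simp))
  obtain ⟨δ, hδ0, hδ⟩ : ∃ δ > 0, ∀ w : ℂ, ‖w - 1‖ < δ → B * ‖w ^ (N + 1) - 1‖ < ε / 2 := by
    have hc : ContinuousAt (fun w : ℂ => B * ‖w ^ (N + 1) - 1‖) 1 := by fun_prop
    have := hc.eventually (gt_mem_nhds (show B * ‖(1:ℂ) ^ (N + 1) - 1‖ < ε / 2 by simpa using hε))
    obtain ⟨δ, hδ0, hδ⟩ := Metric.eventually_nhds_iff.1 this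
    exact ⟨δ, hδ0, fun w hw => hδ (by rwa [dist_eq_norm])⟩
  set D := (B * 4 ^ N) ^ p with hD
  have hD0 : 0 ≤ D := by positivity
  obtain ⟨q, hqd, hq0, hq4, hqK, hqi⟩ := exists_peak hp hKc.isClosed hne hKT hKm hδ0
    (show 0 < η / (D + 1) by positivity)
  have hone : ∀ z : ℂ, ‖z‖ = 1 → z * starRingEnd ℂ z = 1 := by
    intro z hz
    rw [mul_conj, normSq_eq_norm_sq, hz]
    simp
  have hcirc : ∀ z : ℂ, ‖z‖ = 1 → Q.eval z * z * dslope q 0 z ^ (N + 1) =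
      Q.eval z * starRingEnd ℂ z ^ N * q z ^ (N + 1) := by
    intro z hz
    have h1 : q z = z * dslope q 0 z := by
      have := sub_smul_dslope q 0 z
      rw [sub_zero, smul_eq_mul, hq0, sub_zero] at this
      exact this.symm
    rw [h1]
    have : Q.eval z * starRingEnd ℂ z ^ N * (z * dslope q 0 z) ^ (N + 1) =
        Q.eval z * z * dslope q 0 z ^ (N + 1) * (z * starRingEnd ℂ z) ^ N := by ring
    rw [this, hone z hz, one_pow, mul_one]
  have hds : Differentiable ℂ (dslope q 0) := by
    rw [← differentiableOn_univ]
    exact (differentiableOn_dslope univ_mem).2 hqd.differentiableOn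
  have hnorm : ∀ z : ℂ, ‖z‖ = 1 → ‖starRingEnd ℂ z ^ N‖ = 1 := fun z hz => by
    rw [norm_pow, RCLike.norm_conj, hz, one_pow]
  have hhd : Differentiable ℂ fun z => Q.eval z * z * dslope q 0 z ^ (N + 1) :=
    (Q.differentiable.mul differentiable_id).mul (hds.pow _)
  refine ⟨fun z => Q.eval z * z * dslope q 0 z ^ (N + 1), hhd, fun z hz => ?_, ?_⟩
  · have hz1 := mem_sphere_zero_iff_norm.1 (hKT hz)
    simp only [hcirc z hz1, ← hgK z hz]
    have h1 : Q.eval z * starRingEnd ℂ z ^ N * q z ^ (N + 1) - g z =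
        Q.eval z * starRingEnd ℂ z ^ N * (q z ^ (N + 1) - 1) +
          (Q.eval z * starRingEnd ℂ z ^ N - g z) := by ring
    rw [h1]
    refine (norm_add_le _ _).trans_lt ?_
    have h2 : ‖Q.eval z * starRingEnd ℂ z ^ N * (q z ^ (N + 1) - 1)‖ < ε / 2 := by
      rw [norm_mul, norm_mul, hnorm z hz1, mul_one]
      refine lt_of_le_of_lt ?_ (hδ _ (hqK z hz))
      exact mul_le_mul_of_nonneg_right (hB z (hKT hz)) (norm_nonneg _)
    linarith [hQ z hz1]
  · have hqc : Continuous fun ω : Circle => q ω := hqd.continuous.comp (by fun_prop)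
    have hhc : Continuous fun ω : Circle => Q.eval (ω:ℂ) * ω * dslope q 0 ω ^ (N + 1) :=
      hhd.continuous.comp (f := fun ω : Circle => (ω : ℂ)) (by fun_prop)
    have hpt : ∀ ω : Circle, ‖Q.eval (ω:ℂ) * ω * dslope q 0 ω ^ (N + 1)‖ ^ p ≤ D * ‖q ω‖ ^ p := by
      intro ω
      have hω : ‖(ω:ℂ)‖ = 1 := Circle.norm_coe ω
      rw [hD, ← Real.mul_rpow (by positivity) (norm_nonneg _)]
      refine Real.rpow_le_rpow (norm_nonneg _) ?_ hp0.le
      rw [hcirc _ hω, norm_mul, norm_mul, hnorm _ hω, mul_one, norm_pow, pow_succ, mul_assoc]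
      gcongr
      · exact hB _ (by simpa using hω)
      · exact hq4 _ hω
    have hDq : Continuous fun ω : Circle => D * ‖q ω‖ ^ p :=
      continuous_const.mul (hqc.norm.rpow_const fun _ => Or.inr hp0.le)
    rw [powMean] at hqi ⊢
    simp only [ofReal_one, one_mul] at hqi ⊢
    refine (integral_mono (integrable_circleMeas (hhc.norm.rpow_const fun _ => Or.inr hp0.le))
      (integrable_circleMeas hDq) hpt).trans ?_
    rw [integral_const_mul]
    calc D * ∫ ω : Circle, ‖q ω‖ ^ p ∂circleMeas ≤ D * (η / (D + 1)) := by gcongr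
      _ ≤ (D + 1) * (η / (D + 1)) := by gcongr; linarith
      _ = η := mul_div_cancel₀ _ (by positivity)

theorem norm_dilation_le {r R : ℝ} (hr0 : 0 ≤ r) (hr1 : r ≤ 1) {ζ z : ℂ} (hζ : ‖ζ‖ = 1)
    (hz : ‖z‖ ≤ R) : ‖(r : ℂ) * (ζ - z) + z‖ ≤ r + (1 - r) * R := by
  have h1 : (r : ℂ) * (ζ - z) + z = r * ζ + ((1 - r : ℝ) : ℂ) * z := by push_cast; ring
  rw [h1]
  refine (norm_add_le _ _).trans ?_
  rw [norm_mul, norm_mul, norm_real, norm_real, hζ, mul_one, Real.norm_of_nonneg hr0,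
    Real.norm_of_nonneg (sub_nonneg.2 hr1)]
  gcongr

theorem norm_dilation_sub_le {r : ℝ} (hr1 : r ≤ 1) {ζ z : ℂ} (hζ : ‖ζ‖ = 1) (hz : ‖z‖ ≤ 1) :
    ‖(r : ℂ) * (ζ - z) + z - ζ‖ ≤ 2 * (1 - r) := by
  have h1 : (r : ℂ) * (ζ - z) + z - ζ = ((1 - r : ℝ) : ℂ) * (z - ζ) := by push_cast; ring
  rw [h1, norm_mul, norm_real, Real.norm_of_nonneg (sub_nonneg.2 hr1), mul_comm]
  have h2 := norm_sub_le z ζ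
  gcongr
  linarith

theorem exists_mem_lt_of_accPt {ρ : Set ℝ} (hρ : ρ ⊆ Ico 0 1) (h : AccPt (1 : ℝ) (𝓟 ρ)) {a : ℝ}
    (ha : a < 1) : ∃ r ∈ ρ, a < r ∧ 0 ≤ r ∧ r < 1 := by
  obtain ⟨r, hr, hrρ⟩ := mem_closure_iff_nhds.1 (mem_closure_iff_clusterPt.2 h.clusterPt) _
    (Ioi_mem_nhds ha)
  exact ⟨r, hrρ, hr, hρ hrρ⟩

/-- The functions in `H^p` whose dilation by some `r ∈ ρ ∩ (1 - δ, 1)` approximates `φ` on `K`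
up to an error less than `δ`, uniformly with respect to `z` in the disk of radius `R`. -/
def approxSet (p : ℝ) (ρ : Set ℝ) (K : Set ℂ) (φ : ℂ → ℂ) (R δ : ℝ) : Set (HpSpace p) :=
  {f | ∃ r ∈ ρ, 1 - δ < r ∧ ∃ c < δ, ∀ ζ ∈ K, ∀ z ∈ closedBall (0 : ℂ) R,
    ‖f.1 ((r : ℂ) * (ζ - z) + z) - φ ζ‖ ≤ c}

theorem isOpen_approxSet {p : ℝ} (hp : 1 ≤ p) {ρ : Set ℝ} (hρ : ρ ⊆ Ico 0 1) {K : Set ℂ}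
    (hKT : K ⊆ sphere 0 1) (φ : ℂ → ℂ) {R : ℝ} (hR0 : 0 < R) (hR1 : R < 1) (δ : ℝ) :
    IsOpen (approxSet p ρ K φ R δ) := by
  let _ : PseudoMetricSpace (HpSpace p) := hpPseudoMetricSpace hp
  rw [Metric.isOpen_iff]
  rintro f ⟨r, hr, hrδ, c, hc, hf⟩
  obtain ⟨hr0, hr1⟩ := hρ hr
  obtain ⟨C, hC0, hC⟩ := exists_norm_le_mul_hardyNorm (p := p) hp
    (R := r + (1 - r) * R) (by nlinarith) (by nlinarith)
  refine ⟨(δ - c) / (2 * C), div_pos (by linarith) (by linarith), fun g hg =>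
    ⟨r, hr, hrδ, (δ + c) / 2, by linarith, fun ζ hζ z hz => ?_⟩⟩
  have hg' : hardyNorm p (fun z => g.1 z - f.1 z) < (δ - c) / (2 * C) := hg
  have h1 := hC _ (g.2.sub hp f.2) _ (mem_closedBall_zero_iff.2 (norm_dilation_le hr0 hr1.le
    (mem_sphere_zero_iff_norm.1 (hKT hζ)) (mem_closedBall_zero_iff.1 hz)))
  have h2 : C * hardyNorm p (fun z => g.1 z - f.1 z) ≤ (δ - c) / 2 := by
    calc C * hardyNorm p (fun z => g.1 z - f.1 z) ≤ C * ((δ - c) / (2 * C)) := by gcongr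
      _ = (δ - c) / 2 := by field_simp
  have h3 := hf ζ hζ z hz
  have h4 := norm_sub_le_norm_sub_add_norm_sub (g.1 ((r : ℂ) * (ζ - z) + z))
    (f.1 ((r : ℂ) * (ζ - z) + z)) (φ ζ)
  linarith

theorem dense_approxSet {p : ℝ} (hp : 1 ≤ p) {ρ : Set ℝ} (hρ : ρ ⊆ Ico 0 1)
    (hρ1 : AccPt (1 : ℝ) (𝓟 ρ)) {K : Set ℂ} (hKc : IsCompact K) (hKT : K ⊆ sphere 0 1)
    (hKm : arcMeasure K = 0) {φ : ℂ → ℂ} (hφ : ContinuousOn φ K) {R : ℝ} (hR0 : 0 < R)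
    (hR1 : R < 1) {δ : ℝ} (hδ : 0 < δ) : Dense (approxSet p ρ K φ R δ) := by
  let _ : PseudoMetricSpace (HpSpace p) := hpPseudoMetricSpace hp
  rw [Metric.dense_iff]
  intro f ε hε
  have hp0 : 0 < p := by linarith
  have hε' : 0 < (ε / 4) ^ p := by positivity
  obtain ⟨s, ⟨hs0, hs1⟩, hs⟩ := exists_powMean_sub_dilate_le hp f.2.1
    (fun r hr => powMean_le_hardyNorm_rpow hp f.2 hr) hε'
  have hG : DifferentiableOn ℂ (fun z => f.1 (s * z)) (ball 0 (1 / s)) :=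
    differentiableOn_comp_mul f.2.1 hs0
  have hs1' : 1 < 1 / s := (one_lt_div hs0).2 hs1
  have hGc : ContinuousOn (fun z => f.1 (s * z)) (closedBall 0 1) :=
    hG.continuousOn.mono (closedBall_subset_ball hs1')
  obtain ⟨h, hhd, hhK, hhp⟩ := exists_entire_approx hp hKc hKT hKm
    (ψ := fun z => f.1 (s * z) - φ z)
    ((hGc.mono (hKT.trans sphere_subset_closedBall)).sub hφ) (show 0 < δ / 4 by linarith) hε'
  have hud : DifferentiableOn ℂ (fun z => f.1 z - f.1 (s * z)) (ball 0 1) :=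
    f.2.1.sub (hG.mono (ball_subset_ball hs1'.le))
  have hu1 : ∀ r ∈ Ioo (0 : ℝ) 1, powMean p (fun z => f.1 z - f.1 (s * z)) r ^ (1 / p) ≤ ε / 4 :=
    fun r hr => (rpow_one_div_le_iff hp (powMean_nonneg _ _ _) (by positivity)).2 (hs r hr)
  have hh1 : ∀ r ∈ Ioo (0 : ℝ) 1, powMean p h r ^ (1 / p) ≤ ε / 4 := fun r hr =>
    (rpow_one_div_le_iff hp (powMean_nonneg _ _ _) (by positivity)).2
      ((powMean_mono hp (R := 2) hhd.differentiableOn hr.1.le hr.2.le (by norm_num)).trans hhp)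
  have hu := memHp_of_le hp hud hu1
  have hh := memHp_of_le hp hhd.differentiableOn hh1
  have huh : hardyNorm p (fun z => (f.1 z - f.1 (s * z)) + h z) < ε := by
    refine (hardyNorm_add_le hp hu hh).trans_lt ?_
    linarith [hardyNorm_le hp hud hu1, hardyNorm_le hp hhd.differentiableOn hh1]
  refine ⟨⟨_, f.2.sub hp (hu.add hp hh)⟩, ?_, ?_⟩
  · change hardyNorm p (fun z => f.1 z - ((f.1 z - f.1 (s * z)) + h z) - f.1 z) < ε
    rw [hardyNorm_sub_comm]
    simpa only [sub_sub_cancel] using huh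
  · have hW : ContinuousOn (fun z => f.1 (s * z) - h z) (closedBall 0 1) :=
      hGc.sub hhd.continuous.continuousOn
    obtain ⟨d, hd0, hd⟩ := Metric.uniformContinuousOn_iff.1
      ((isCompact_closedBall (0 : ℂ) 1).uniformContinuousOn_of_continuous hW) (δ / 4) (by linarith)
    obtain ⟨r, hr, hrd, hr0, hr1⟩ := exists_mem_lt_of_accPt hρ hρ1
      (show 1 - min δ (d / 2) < 1 by linarith [lt_min hδ (half_pos hd0)])
    have hδ' := min_le_left δ (d / 2)
    have hd' := min_le_right δ (d / 2)
    refine ⟨r, hr, by linarith, δ / 2, by linarith, fun ζ hζ z hz => ?_⟩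
    have hζ1 := mem_sphere_zero_iff_norm.1 (hKT hζ)
    have hz1 := mem_closedBall_zero_iff.1 hz
    have h1 : (r : ℂ) * (ζ - z) + z ∈ closedBall (0 : ℂ) 1 :=
      mem_closedBall_zero_iff.2 ((norm_dilation_le hr0 hr1.le hζ1 hz1).trans (by nlinarith))
    have h2 := norm_dilation_sub_le hr1.le hζ1 (hz1.trans hR1.le)
    have h3 := hd _ h1 ζ (sphere_subset_closedBall (hKT hζ)) (by rw [dist_eq_norm]; linarith)
    rw [dist_eq_norm] at h3
    simp only [sub_add_eq_sub_sub, sub_sub_cancel]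
    set w := (r : ℂ) * (ζ - z) + z
    have h4 := hhK ζ hζ
    have h5 : f.1 (s * w) - h w - φ ζ =
        (f.1 (s * w) - h w - (f.1 (s * ζ) - h ζ)) - (h ζ - (f.1 (s * ζ) - φ ζ)) := by ring
    have h6 := norm_sub_le (f.1 (s * w) - h w - (f.1 (s * ζ) - h ζ)) (h ζ - (f.1 (s * ζ) - φ ζ))
    rw [← h5] at h6
    linarith

theorem exists_seq_continuous_dense {K : Set ℂ} (hK : IsCompact K) :
    ∃ φ : ℕ → ℂ → ℂ, (∀ j, Continuous (φ j)) ∧ ∀ ψ, ContinuousOn ψ K → ∀ ε > 0,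
      ∃ j, ∀ z ∈ K, ‖φ j z - ψ z‖ < ε := by
  have : CompactSpace K := isCompact_iff_compactSpace.1 hK
  choose Φ hΦ using fun j : ℕ =>
    ContinuousMap.exists_restrict_eq hK.isClosed (TopologicalSpace.denseSeq C(K, ℂ) j)
  refine ⟨fun j => Φ j, fun j => (Φ j).continuous, fun ψ hψ ε hε => ?_⟩
  obtain ⟨j, hj⟩ := (TopologicalSpace.denseRange_denseSeq C(K, ℂ)).exists_dist_lt
    ⟨K.domRestrict ψ, hψ.domRestrict⟩ hε
  refine ⟨j, fun z hz => ?_⟩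
  have h1 : Φ j z = TopologicalSpace.denseSeq C(K, ℂ) j ⟨z, hz⟩ := DFunLike.congr_fun (hΦ j) ⟨z, hz⟩
  simp only [h1]
  rw [norm_sub_rev, ← dist_eq_norm]
  exact (ContinuousMap.dist_apply_le_dist (⟨z, hz⟩ : K)).trans_lt hj

theorem le_biSup_biSup {F : ℂ → ℂ → ℝ} {K L : Set ℂ} {M : ℝ} (hM0 : 0 ≤ M)
    (hM : ∀ ζ ∈ K, ∀ z ∈ L, F ζ z ≤ M) {ζ z : ℂ} (hζ : ζ ∈ K) (hz : z ∈ L) :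
    F ζ z ≤ ⨆ ζ ∈ K, ⨆ z ∈ L, F ζ z := by
  have h1 : ∀ ζ ∈ K, ∀ z, ⨆ _ : z ∈ L, F ζ z ≤ M := fun ζ hζ z =>
    Real.iSup_le (hM ζ hζ z) hM0
  have h2 : ∀ ζ, ⨆ _ : ζ ∈ K, ⨆ z ∈ L, F ζ z ≤ M := fun ζ =>
    Real.iSup_le (fun hζ => Real.iSup_le (h1 ζ hζ) hM0) hM0
  refine le_ciSup_of_le ⟨M, forall_mem_range.2 h2⟩ ζ ?_
  rw [ciSup_pos hζ]
  refine le_ciSup_of_le ⟨M, forall_mem_range.2 (h1 ζ hζ)⟩ z ?_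
  rw [ciSup_pos hz]

theorem mem_approxSet_of_mem_VHp {p : ℝ} {ρ : Set ℝ} (hρ : ρ ⊆ Ico 0 1) {K : Set ℂ}
    (hKc : IsCompact K) (hKT : K ⊆ sphere 0 1) {f : HpSpace p} (hf : f ∈ VHp p ρ K)
    {φ : ℂ → ℂ} (hφ : ContinuousOn φ K) {R : ℝ} (hR1 : R < 1) {δ : ℝ}
    (hδ : 0 < δ) : f ∈ approxSet p ρ K φ R δ := by
  obtain ⟨r, hrρ, -, hr1, hrt⟩ := hf φ hφ _ (isCompact_closedBall 0 R) (closedBall_subset_ball hR1)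
  obtain ⟨n, hn1, hn2⟩ := ((hr1.eventually (lt_mem_nhds (show 1 - δ < 1 by linarith))).and
    (hrt.eventually (gt_mem_nhds hδ))).exists
  obtain ⟨h0, h1⟩ := hρ (hrρ n)
  have hR' : r n + (1 - r n) * R < 1 := by nlinarith
  obtain ⟨A, hA⟩ := (isCompact_closedBall (0 : ℂ) (r n + (1 - r n) * R)).exists_bound_of_continuousOn
    (f.2.1.continuousOn.mono (closedBall_subset_ball hR'))
  obtain ⟨B, hB⟩ := hKc.exists_bound_of_continuousOn hφ
  have hM : ∀ ζ ∈ K, ∀ z ∈ closedBall (0 : ℂ) R,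
      ‖f.1 ((r n : ℂ) * (ζ - z) + z) - φ ζ‖ ≤ max (A + B) 0 := fun ζ hζ z hz => by
    refine le_max_of_le_left ((norm_sub_le _ _).trans (add_le_add (hA _ ?_) (hB ζ hζ)))
    exact mem_closedBall_zero_iff.2 (norm_dilation_le h0 h1.le
      (mem_sphere_zero_iff_norm.1 (hKT hζ)) (mem_closedBall_zero_iff.1 hz))
  exact ⟨r n, hrρ n, hn1, _, hn2, fun ζ hζ z hz => le_biSup_biSup (le_max_right _ _) hM hζ hz⟩

theorem mem_VHp_of_forall_exists {p : ℝ} {ρ : Set ℝ} (hρ : ρ ⊆ Ico 0 1) {K : Set ℂ}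
    {f : HpSpace p} (hf : ∀ φ : ℂ → ℂ, ContinuousOn φ K → ∀ L, IsCompact L → L ⊆ ball (0 : ℂ) 1 →
      ∀ δ > 0, ∃ r ∈ ρ, 1 - δ < r ∧ ∀ ζ ∈ K, ∀ z ∈ L,
        ‖f.1 ((r : ℂ) * (ζ - z) + z) - φ ζ‖ ≤ δ) : f ∈ VHp p ρ K := by
  intro φ hφ L hL hL1
  have hstep : ∀ (n : ℕ) (a : ℝ), a < 1 → ∃ r, a < r ∧ r ∈ ρ ∧ 1 - 1 / ((n : ℝ) + 1) < r ∧
      ∀ ζ ∈ K, ∀ z ∈ L, ‖f.1 ((r : ℂ) * (ζ - z) + z) - φ ζ‖ ≤ 1 / ((n : ℝ) + 1) := by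
    intro n a ha
    have hn : (0 : ℝ) < 1 / ((n : ℝ) + 1) := by positivity
    obtain ⟨r, hr, h1, h2⟩ := hf φ hφ L hL hL1 (min (1 / ((n : ℝ) + 1)) (1 - a))
      (lt_min hn (by linarith))
    have h3 := min_le_left (1 / ((n : ℝ) + 1)) (1 - a)
    have h4 := min_le_right (1 / ((n : ℝ) + 1)) (1 - a)
    exact ⟨r, by linarith, hr, by linarith, fun ζ hζ z hz => (h2 ζ hζ z hz).trans h3⟩
  choose! F hF1 hF2 hF3 hF4 using hstep
  obtain ⟨r, hr0, hrs⟩ : ∃ r : ℕ → ℝ, r 0 = F 0 0 ∧ ∀ n, r (n + 1) = F (n + 1) (r n) :=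
    ⟨fun n => n.rec (F 0 0) fun n x => F (n + 1) x, rfl, fun _ => rfl⟩
  have hr : ∀ n, ∃ a < 1, r n = F n a := fun n => by
    induction n with
    | zero => exact ⟨0, one_pos, hr0⟩
    | succ n ih =>
      obtain ⟨a, ha, h⟩ := ih
      exact ⟨r n, h ▸ (hρ (hF2 n a ha)).2, hrs n⟩
  have hrρ : ∀ n, r n ∈ ρ := fun n => by
    obtain ⟨a, ha, h⟩ := hr n
    exact h ▸ hF2 n a ha
  have hr1 : ∀ n : ℕ, 1 - 1 / ((n : ℝ) + 1) < r n := fun n => by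
    obtain ⟨a, ha, h⟩ := hr n
    exact h ▸ hF3 n a ha
  have hr2 : ∀ n : ℕ, ∀ ζ ∈ K, ∀ z ∈ L,
      ‖f.1 ((r n : ℂ) * (ζ - z) + z) - φ ζ‖ ≤ 1 / ((n : ℝ) + 1) := fun n => by
    obtain ⟨a, ha, h⟩ := hr n
    exact h ▸ hF4 n a ha
  have ht := tendsto_one_div_add_atTop_nhds_zero_nat (𝕜 := ℝ)
  refine ⟨r, hrρ, strictMono_nat_of_lt_succ fun n => ?_, ?_, ?_⟩
  · exact hrs n ▸ hF1 (n + 1) (r n) (hρ (hrρ n)).2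
  · exact tendsto_of_tendsto_of_tendsto_of_le_of_le (by simpa using tendsto_const_nhds.sub ht)
      tendsto_const_nhds (fun n => (hr1 n).le) fun n => (hρ (hrρ n)).2.le
  · refine squeeze_zero (fun n => ?_) (fun n => ?_) ht
    · exact Real.iSup_nonneg fun _ => Real.iSup_nonneg fun _ => Real.iSup_nonneg fun _ =>
        Real.iSup_nonneg fun _ => norm_nonneg _
    · have hn : (0 : ℝ) ≤ 1 / ((n : ℝ) + 1) := by positivity
      exact Real.iSup_le (fun ζ => Real.iSup_le (fun hζ => Real.iSup_le (fun z =>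
        Real.iSup_le (fun hz => hr2 n ζ hζ z hz) hn) hn) hn) hn

theorem VHp_eq_iInter {p : ℝ} {ρ : Set ℝ} (hρ : ρ ⊆ Ico 0 1) {K : Set ℂ}
    (hKc : IsCompact K) (hKT : K ⊆ sphere 0 1) {φ : ℕ → ℂ → ℂ} (hφ : ∀ j, Continuous (φ j))
    (hφd : ∀ ψ, ContinuousOn ψ K → ∀ ε > 0, ∃ j, ∀ z ∈ K, ‖φ j z - ψ z‖ < ε) :
    VHp p ρ K = ⋂ i : ℕ × ℕ × ℕ,
      approxSet p ρ K (φ i.1) (1 - 1 / ((i.2.1 : ℝ) + 2)) (1 / ((i.2.2 : ℝ) + 1)) := by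
  refine Subset.antisymm (fun f hf => mem_iInter.2 fun i => ?_) fun f hf => ?_
  · have : (0 : ℝ) < 1 / ((i.2.1 : ℝ) + 2) := by positivity
    exact mem_approxSet_of_mem_VHp hρ hKc hKT hf (hφ i.1).continuousOn (by linarith)
      (by positivity)
  · refine mem_VHp_of_forall_exists hρ fun ψ hψ L hL hL1 δ hδ => ?_
    obtain ⟨R, hR0, hR1, hLR⟩ := exists_closedBall_of_isCompact hL hL1
    obtain ⟨j, hj⟩ := hφd ψ hψ (δ / 2) (half_pos hδ)
    obtain ⟨k, hk⟩ := exists_nat_one_div_lt (sub_pos.2 hR1)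
    obtain ⟨n, hn⟩ := exists_nat_one_div_lt (half_pos hδ)
    obtain ⟨r, hr, hrn, c, hc, hrc⟩ := mem_iInter.1 hf (j, k, n)
    simp only at hrn hc hrc
    refine ⟨r, hr, by linarith, fun ζ hζ z hz => ?_⟩
    have hk' : 1 / ((k : ℝ) + 2) ≤ 1 / ((k : ℝ) + 1) := by gcongr; norm_num
    have h1 := hrc ζ hζ z (closedBall_subset_closedBall (by linarith) (hLR hz))
    have h2 := hj ζ hζ
    have h3 := norm_sub_le_norm_sub_add_norm_sub (f.1 ((r : ℂ) * (ζ - z) + z)) (φ j ζ) (ψ ζ)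
    linarith

/-- Theorem (hardymain): for `1 ≤ p < ∞`, `ρ ⊆ [0,1)` with `1` as a limit point, and `K ⊆ 𝕋`
compact of zero arc length, `𝒱_{H^p}^K(𝔻,ρ)` is a dense `G_δ` subset of `H^p(𝔻)`. -/
theorem statement_0 (p : ℝ) (hp : 1 ≤ p)
    (ρ : Set ℝ) (hρ : ρ ⊆ Set.Ico (0:ℝ) 1) (hρ1 : AccPt (1:ℝ) (Filter.principal ρ))
    (K : Set ℂ) (hKc : IsCompact K) (hKT : K ⊆ Metric.sphere (0:ℂ) 1)
    (hKm : arcMeasure K = 0) :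
    IsGδ (VHp p ρ K) ∧ Dense (VHp p ρ K) := by
  obtain ⟨φ, hφ, hφd⟩ := exists_seq_continuous_dense hKc
  have hR1 (k : ℕ) : 1 - 1 / ((k : ℝ) + 2) < 1 := sub_lt_self _ (by positivity)
  have hR0 (k : ℕ) : 0 < 1 - 1 / ((k : ℝ) + 2) := by
    rw [sub_pos, div_lt_one (by positivity)]
    linarith [k.cast_nonneg (α := ℝ)]
  have ho := fun i : ℕ × ℕ × ℕ => isOpen_approxSet hp hρ hKT (φ i.1) (hR0 i.2.1) (hR1 i.2.1)
    (1 / ((i.2.2 : ℝ) + 1))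
  have := baireSpace_hpSpace hp
  rw [VHp_eq_iInter hρ hKc hKT hφ hφd]
  exact ⟨.iInter_of_isOpen ho, dense_iInter_of_isOpen ho fun i =>
    dense_approxSet hp hρ hρ1 hKc hKT hKm (hφ i.1).continuousOn (hR0 i.2.1) (hR1 i.2.1)
      (by positivity)⟩
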